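/- arXiv:1209.5739 — 16 statements merged into one kernel-verified Lean document; each statement's English description precedes it below -/
import Mathlib

section
/- Let a be a real number and let g : ℝ → ℝ be twice differentiable on [a, ∞) with g′(x) → 0 as x → ∞, and suppose there exists x₀ ≥ a such that either g′(x) ≥ 0 and g″(x) ≤ 0 for all x ≥ x₀, or g′(x) ≤ 0 and g″(x) ≥ 0 for all x ≥ x₀. Then the limit lim_{n→∞} ( g(a+n) − ∑_{k=0}^{n} g′(a+k) ) exists, i.e. there is a real number L such that the sequence n ↦ g(a+n) − ∑_{k=0}^{n} g′(a+k) (n ∈ ℕ) converges to L. -/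
open Filter Finset

/-- If `g' ≥ 0` is antitone on `[x₀, ∞)` and is the derivative of `g` there, then the sequence
`g (a + n) - ∑ k ≤ n, g' (a + k)` converges. -/
theorem exists_tendsto_sub_sum_of_antitoneOn {a x₀ : ℝ} {g g' : ℝ → ℝ}
    (hg : ∀ x, x₀ ≤ x → HasDerivAt g (g' x) x) (hanti : AntitoneOn g' (Set.Ici x₀))
    (hnonneg : ∀ x, x₀ ≤ x → 0 ≤ g' x) :
    ∃ L : ℝ, Tendsto (fun n : ℕ => g (a + n) - ∑ k ∈ Finset.range (n + 1), g' (a + k))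
      atTop (nhds L) := by
  set s : ℕ → ℝ := fun n => g (a + n) - ∑ k ∈ Finset.range (n + 1), g' (a + k) with hs
  obtain ⟨N, hN⟩ := exists_nat_ge (x₀ - a)
  have mean (x : ℝ) (hx : x₀ ≤ x) : g' (x + 1) ≤ g (x + 1) - g x ∧ g (x + 1) - g x ≤ g' x := by
    obtain ⟨c, ⟨hxc, hcx⟩, hc⟩ := exists_hasDerivAt_eq_slope g g' (lt_add_one x)
      (fun y hy => (hg y (hx.trans hy.1)).continuousAt.continuousWithinAt)
      (fun y hy => hg y (hx.trans hy.1.le))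
    rw [add_sub_cancel_left, div_one] at hc
    have hc₀ : x₀ ≤ c := hx.trans hxc.le
    rw [← hc]
    exact ⟨hanti hc₀ (hc₀.trans hcx.le) hcx.le, hanti hx hc₀ hxc.le⟩
  have hle (n : ℕ) : x₀ ≤ a + (n + N : ℕ) := by
    push_cast
    linarith [n.cast_nonneg (α := ℝ)]
  have step (n : ℕ) : s (n + 1) = s n + (g (a + n + 1) - g (a + n)) - g' (a + n + 1) := by
    simp only [hs]
    rw [Finset.sum_range_succ _ (n + 1)]
    push_cast
    rw [← add_assoc]
    ring
  have hmono : Monotone fun n => s (n + N) := monotone_nat_of_le_succ fun n => by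
    rw [add_right_comm, step]
    linarith [(mean _ (hle n)).1]
  have hupper : Antitone fun n => s (n + N) + g' (a + (n + N : ℕ)) :=
    antitone_nat_of_succ_le fun n => by
      rw [add_right_comm, step, Nat.cast_succ, ← add_assoc]
      linarith [(mean _ (hle n)).2]
  have hbdd : BddAbove (Set.range fun n => s (n + N)) := by
    refine ⟨s (0 + N) + g' (a + (0 + N : ℕ)), ?_⟩
    rintro _ ⟨n, rfl⟩
    have h₁ := hupper n.zero_le
    have h₂ := hnonneg _ (hle n)
    dsimp only at h₁ ⊢
    linarith
  exact ⟨_, (tendsto_add_atTop_iff_nat N).1 (tendsto_atTop_ciSup hmono hbdd)⟩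

/-- If `g` is twice differentiable on `[a, ∞)`, its derivative tends to `0` at infinity, and
`g` is eventually non-decreasing and concave or eventually non-increasing and convex (i.e. `g` is
nearly convergent), then the limit `lim_{n→∞} (g(a+n) − ∑_{k=0}^{n} g′(a+k))` exists. -/
theorem stmt_0 (a : ℝ) (g : ℝ → ℝ)
    (hg : ∀ x ∈ Set.Ici a, DifferentiableAt ℝ g x)
    (hg' : ∀ x ∈ Set.Ici a, DifferentiableAt ℝ (deriv g) x)
    (hlim : Tendsto (deriv g) atTop (nhds 0))
    (hshape : ∃ x₀ : ℝ, a ≤ x₀ ∧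
      ((∀ x, x₀ ≤ x → 0 ≤ deriv g x ∧ deriv (deriv g) x ≤ 0) ∨
       (∀ x, x₀ ≤ x → deriv g x ≤ 0 ∧ 0 ≤ deriv (deriv g) x))) :
    ∃ L : ℝ, Tendsto (fun n : ℕ => g (a + n) - ∑ k ∈ Finset.range (n + 1), deriv g (a + k))
      atTop (nhds L) := by
  obtain ⟨x₀, hax₀, h | h⟩ := hshape
  · refine exists_tendsto_sub_sum_of_antitoneOn
      (fun x hx => (hg x (hax₀.trans hx)).hasDerivAt) ?_ fun x hx => (h x hx).1
    refine antitoneOn_of_deriv_nonpos (convex_Ici x₀)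
      (fun x hx => (hg' x (hax₀.trans hx)).continuousAt.continuousWithinAt)
      (fun x hx => (hg' x (hax₀.trans (interior_subset hx))).differentiableWithinAt)
      fun x hx => (h x (interior_subset hx)).2
  · have hmono : MonotoneOn (deriv g) (Set.Ici x₀) :=
      monotoneOn_of_deriv_nonneg (convex_Ici x₀)
        (fun x hx => (hg' x (hax₀.trans hx)).continuousAt.continuousWithinAt)
        (fun x hx => (hg' x (hax₀.trans (interior_subset hx))).differentiableWithinAt)
        fun x hx => (h x (interior_subset hx)).2
    obtain ⟨L, hL⟩ := exists_tendsto_sub_sum_of_antitoneOn (a := a) (g := -g) (g' := -deriv g)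
      (fun x hx => (hg x (hax₀.trans hx)).hasDerivAt.neg) hmono.neg
      fun x hx => neg_nonneg.2 (h x hx).1
    refine ⟨-L, hL.neg.congr fun n => ?_⟩
    simp only [Pi.neg_apply, Finset.sum_neg_distrib]
    ring
end

section
/- Let a ∈ ℝ, let g : ℝ → ℝ be infinitely differentiable on [a, ∞), and let m ≥ 1 be an integer. Suppose p and q are real polynomials of degree at most m, and F_p, F_q : ℝ → ℝ are functions satisfying: F_p(x) = p(x) for all x ∈ [a, a+1], F_p(x) = g(x) + F_p(x−1) for all x > a+1, F_p(a) = g(a), and the same three conditions for F_q with q in place of p. If F_p and F_q are both (m−1)-times continuously differentiable on [a, ∞), then p = q. -/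
open Polynomial Filter Topology

theorem Polynomial.iteratedDeriv_eval (P : ℝ[X]) (k : ℕ) :
    iteratedDeriv k (fun x ↦ P.eval x) = fun x ↦ (derivative^[k] P).eval x := by
  induction k with
  | zero => simp
  | succ k ih =>
    rw [iteratedDeriv_succ, ih, Function.iterate_succ_apply']
    ext x
    exact Polynomial.deriv _

/-- If a function of class `C^n` on an open set containing `c` is polynomial on each side of `c`,
the two polynomials have the same derivatives at `c` up to order `n`. -/
theorem ContDiffOn.eval_iterate_derivative_eq {f : ℝ → ℝ} {U : Set ℝ} {c : ℝ} {n k : ℕ}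
    (hf : ContDiffOn ℝ n f U) (hU : IsOpen U) (hc : c ∈ U) (hk : k ≤ n) {P Q : ℝ[X]}
    (hP : f =ᶠ[𝓝[<] c] fun x ↦ P.eval x) (hQ : f =ᶠ[𝓝[>] c] fun x ↦ Q.eval x) :
    (derivative^[k] P).eval c = (derivative^[k] Q).eval c := by
  have hcont : ContinuousAt (iteratedDeriv k f) c := by
    have h := hf.continuousOn_iteratedDerivWithin (m := k) (by exact_mod_cast hk) hU.uniqueDiffOn
    exact (h.congr fun x hx ↦ (iteratedDerivWithin_of_isOpen hU hx).symm).continuousAt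
      (hU.mem_nhds hc)
  have key {s : Set ℝ} (hs : IsOpen s) [(𝓝[s] c).NeBot] {R : ℝ[X]}
      (hR : f =ᶠ[𝓝[s] c] fun x ↦ R.eval x) :
      iteratedDeriv k f c = (derivative^[k] R).eval c := by
    refine tendsto_nhds_unique (hcont.tendsto.mono_left (nhdsWithin_le_nhds (s := s)))
      (((derivative^[k] R).continuous.tendsto c).mono_left nhdsWithin_le_nhds |>.congr' ?_)
    filter_upwards [eventually_eventually_nhdsWithin.2 hR, self_mem_nhdsWithin] with x hx hxs
    rw [hs.nhdsWithin_eq hxs] at hx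
    rw [EventuallyEq.iteratedDeriv_eq k hx, R.iteratedDeriv_eval]
  rw [← key isOpen_Iio hP, ← key isOpen_Ioi hQ]

theorem Polynomial.eq_zero_of_degree_lt_of_isRoot_iterate_derivative {P : ℝ[X]} {c : ℝ} {m : ℕ}
    (hdeg : P.degree < m) (hroot : ∀ k < m, (derivative^[k] P).IsRoot c) : P = 0 := by
  by_contra hP
  have hlt : P.natDegree < m := (natDegree_lt_iff_degree_lt hP).2 hdeg
  have h := lt_rootMultiplicity_of_isRoot_iterate_derivative (n := P.natDegree) hP
    fun k hk ↦ hroot k (hk.trans_lt hlt)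
  rw [← count_roots] at h
  exact absurd ((Multiset.count_le_card c P.roots).trans P.card_roots') h.not_ge

theorem Polynomial.degree_sub_comp_X_sub_C_lt {P : ℝ[X]} (hP : P ≠ 0) (c : ℝ) :
    (P - P.comp (X - C c)).degree < P.degree := by
  have hne : P.comp (X - C c) ≠ 0 := by
    rw [← leadingCoeff_ne_zero, leadingCoeff_comp (by simp)]
    simpa using hP
  apply degree_sub_lt_left _ hP
  · rw [leadingCoeff_comp (by simp)]
    simp
  · rw [degree_eq_natDegree hP, degree_eq_natDegree hne, natDegree_comp]
    simp

/-- A polynomial invariant under a unit shift that has a root vanishes. -/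
theorem Polynomial.eq_zero_of_comp_X_sub_one_eq {P : ℝ[X]} {a : ℝ} (h : P.comp (X - C 1) = P)
    (ha : P.IsRoot a) : P = 0 := by
  have hroot (n : ℕ) : P.IsRoot (a + n) := by
    induction n with
    | zero => simpa using ha
    | succ n ih =>
      rw [IsRoot.def, ← h]
      simpa [← add_assoc] using ih
  refine P.eq_zero_of_infinite_isRoot (Set.infinite_of_injective_forall_mem (f := fun n : ℕ ↦ a + n)
    (fun i j hij ↦ by simpa using hij) hroot)

/-- Statement of Uniqueness: given `g` smooth on `[a, ∞)` and an integer `m ≥ 1`, if two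
polynomials `p, q` of degree at most `m` generate, via the recurrence `F(x) = g(x) + F(x-1)`
with `F = p` (resp. `q`) on `[a, a+1]` and `F(a) = g(a)`, functions that are `(m-1)`-times
continuously differentiable on `[a, ∞)`, then `p = q`. -/
theorem stmt_1 (a : ℝ) (g : ℝ → ℝ) (hg : ContDiffOn ℝ (⊤ : ℕ∞) g (Set.Ici a))
    (m : ℕ) (hm : 1 ≤ m)
    (p q : Polynomial ℝ) (hp : p.degree ≤ (m : WithBot ℕ)) (hq : q.degree ≤ (m : WithBot ℕ))
    (Fp Fq : ℝ → ℝ)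
    (hFp1 : ∀ x ∈ Set.Icc a (a + 1), Fp x = p.eval x)
    (hFp2 : ∀ x : ℝ, a + 1 < x → Fp x = g x + Fp (x - 1))
    (hFp3 : Fp a = g a)
    (hFq1 : ∀ x ∈ Set.Icc a (a + 1), Fq x = q.eval x)
    (hFq2 : ∀ x : ℝ, a + 1 < x → Fq x = g x + Fq (x - 1))
    (hFq3 : Fq a = g a)
    (hFpd : ContDiffOn ℝ (m - 1 : ℕ) Fp (Set.Ici a))
    (hFqd : ContDiffOn ℝ (m - 1 : ℕ) Fq (Set.Ici a)) :
    p = q := by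
  have hr : (p - q).IsRoot a := by
    have ha : a ∈ Set.Icc a (a + 1) := by simp
    simp [← hFp1 a ha, ← hFq1 a ha, hFp3, hFq3]
  rw [← sub_eq_zero]
  by_contra hne
  have hd : ContDiffOn ℝ (m - 1 : ℕ) (fun x ↦ Fp x - Fq x) (Set.Ioi a) :=
    (hFpd.sub hFqd).mono Set.Ioi_subset_Ici_self
  have hleft : (fun x ↦ Fp x - Fq x) =ᶠ[𝓝[<] (a + 1)] fun x ↦ (p - q).eval x := by
    filter_upwards [Ioo_mem_nhdsLT (lt_add_one a)] with x hx
    simp [hFp1 x ⟨hx.1.le, hx.2.le⟩, hFq1 x ⟨hx.1.le, hx.2.le⟩]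
  have hright : (fun x ↦ Fp x - Fq x) =ᶠ[𝓝[>] (a + 1)]
      fun x ↦ ((p - q).comp (X - C 1)).eval x := by
    filter_upwards [Ioo_mem_nhdsGT (lt_add_one (a + 1))] with x hx
    have hx' : x - 1 ∈ Set.Icc a (a + 1) := ⟨by linarith [hx.1], by linarith [hx.2]⟩
    simp [hFp2 x hx.1, hFq2 x hx.1, hFp1 _ hx', hFq1 _ hx']
  have hdeg : (p - q).degree ≤ m := (degree_sub_le p q).trans (max_le hp hq)
  have hzero := eq_zero_of_degree_lt_of_isRoot_iterate_derivative (c := a + 1)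
    ((degree_sub_comp_X_sub_C_lt hne 1).trans_le hdeg) fun k hk ↦ by
      rw [iterate_derivative_sub, IsRoot.def, eval_sub, sub_eq_zero]
      exact hd.eval_iterate_derivative_eq isOpen_Ioi (lt_add_one a) (by omega) hleft hright
  exact hne (eq_zero_of_comp_X_sub_one_eq (sub_eq_zero.1 hzero).symm hr)
end

section
/- Let f : ℝ → ℝ be infinitely differentiable on (−1, ∞) and satisfy: (1) f(x) = log x + f(x−1) for all x > 0; (2) f(1) = 0; (3) for every integer r ≥ 0 there exists a real number n_r such that the r-th derivative of f is monotone (either non-decreasing or non-increasing) on (n_r, ∞). Then f(x) = log Γ(x+1) for all x > −1, where Γ is the Gamma function. -/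
/-- If `g (y + 1) = g y + log y` and `g` is convex on `(N, ∞)`, then it is convex on `(0, ∞)`. -/
theorem convexOn_Ioi_zero_of_convexOn_Ioi_natCast {g : ℝ → ℝ}
    (hg : ∀ y : ℝ, 0 < y → g (y + 1) = g y + Real.log y) (N : ℕ)
    (h : ConvexOn ℝ (Set.Ioi (N : ℝ)) g) : ConvexOn ℝ (Set.Ioi (0 : ℝ)) g := by
  induction N with
  | zero => simpa using h
  | succ N ih =>
    apply ih
    have hN : (0 : ℝ) ≤ N := N.cast_nonneg
    have hlog : ConcaveOn ℝ (Set.Ioi (N : ℝ)) Real.log :=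
      strictConcaveOn_log_Ioi.concaveOn.subset (Set.Ioi_subset_Ioi hN) (convex_Ioi _)
    have hshift : ConvexOn ℝ (Set.Ioi (N : ℝ)) (fun y => g (y + 1)) := by
      refine ⟨convex_Ioi _, fun x hx y hy a b ha hb hab => ?_⟩
      have key := h.2 (x := x + 1) (y := y + 1) (by simpa using hx) (by simpa using hy) ha hb hab
      have hpt : a • x + b • y + 1 = a • (x + 1) + b • (y + 1) := by
        simp only [smul_eq_mul]
        linear_combination -hab
      simpa only [hpt] using key
    refine (hshift.sub hlog).congr fun y hy => ?_
    simp [hg y (hN.trans_lt hy)]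

/-- A function satisfying the log-factorial recurrence is not concave near infinity. -/
theorem not_concaveOn_Ioi_of_log_recurrence {f : ℝ → ℝ}
    (hrec : ∀ x : ℝ, 0 < x → f x = Real.log x + f (x - 1)) {a : ℝ} (ha : 0 ≤ a) :
    ¬ ConcaveOn ℝ (Set.Ioi a) f := by
  intro h
  have key := h.2 (x := a + 1) (y := a + 3) (by simp) (by simp)
    (by norm_num : (0 : ℝ) ≤ 1 / 2) (by norm_num : (0 : ℝ) ≤ 1 / 2) (by norm_num)
  have hmid : (1 / 2 : ℝ) • (a + 1) + (1 / 2 : ℝ) • (a + 3) = a + 2 := by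
    simp only [smul_eq_mul]
    ring
  rw [hmid] at key
  have h3 := hrec (a + 3) (by linarith)
  have h2 := hrec (a + 2) (by linarith)
  rw [show a + 3 - 1 = a + 2 by ring] at h3
  rw [show a + 2 - 1 = a + 1 by ring] at h2
  have hlt : Real.log (a + 2) < Real.log (a + 3) :=
    Real.log_lt_log (by linarith) (by linarith)
  simp only [smul_eq_mul] at key
  linarith

/-- Uniqueness of the Gamma function as the natural generalization of the factorial: a smooth
function on `(-1, ∞)` satisfying the log-factorial recurrence `f(x) = log x + f(x-1)`, the
initial condition `f(1) = 0`, and whose every derivative is eventually monotone, must equal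
`log Γ(x+1)`. -/
theorem stmt_2 (f : ℝ → ℝ)
    (hf : ContDiffOn ℝ (⊤ : ℕ∞) f (Set.Ioi (-1 : ℝ)))
    (hrec : ∀ x : ℝ, 0 < x → f x = Real.log x + f (x - 1))
    (hinit : f 1 = 0)
    (hmono : ∀ r : ℕ, ∃ nr : ℝ,
      MonotoneOn (iteratedDeriv r f) (Set.Ioi nr) ∨ AntitoneOn (iteratedDeriv r f) (Set.Ioi nr)) :
    ∀ x : ℝ, -1 < x → f x = Real.log (Real.Gamma (x + 1)) := by
  obtain ⟨n, hn⟩ := hmono 1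
  rw [iteratedDeriv_one] at hn
  obtain ⟨N, hN⟩ := exists_nat_ge n
  have hN0 : (0 : ℝ) ≤ N := N.cast_nonneg
  have hdiff : DifferentiableOn ℝ f (Set.Ioi (N : ℝ)) :=
    (hf.differentiableOn (by simp)).mono (Set.Ioi_subset_Ioi (by linarith))
  have hsub : interior (Set.Ioi (N : ℝ)) ⊆ Set.Ioi n := by
    rw [interior_Ioi]
    exact Set.Ioi_subset_Ioi hN
  have hconv : ConvexOn ℝ (Set.Ioi (N : ℝ)) f := by
    rcases hn with hn | hn
    · exact (hn.mono hsub).convexOn_of_deriv (convex_Ioi _) hdiff.continuousOn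
        (hdiff.mono interior_subset)
    · exact absurd ((hn.mono hsub).concaveOn_of_deriv (convex_Ioi _) hdiff.continuousOn
        (hdiff.mono interior_subset)) (not_concaveOn_Ioi_of_log_recurrence hrec hN0)
  have hrec' : ∀ y : ℝ, 0 < y → f y = f (y - 1) + Real.log y := fun y hy => by
    rw [hrec y hy, add_comm]
  have hg : ∀ y : ℝ, 0 < y → f (y + 1 - 1) = f (y - 1) + Real.log y := fun y hy => by
    rw [add_sub_cancel_right, hrec' y hy]
  have hgconv : ConvexOn ℝ (Set.Ioi (0 : ℝ)) (fun y => f (y - 1)) := by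
    refine convexOn_Ioi_zero_of_convexOn_Ioi_natCast hg (N + 1) ?_
    refine ⟨convex_Ioi _, fun x hx y hy a b ha hb hab => ?_⟩
    rw [Set.mem_Ioi, Nat.cast_add_one] at hx hy
    have key := hconv.2 (x := x - 1) (y := y - 1) (lt_sub_iff_add_lt.2 hx)
      (lt_sub_iff_add_lt.2 hy) ha hb hab
    have hpt : a • x + b • y - 1 = a • (x - 1) + b • (y - 1) := by
      simp only [smul_eq_mul]
      linear_combination hab
    simpa only [hpt] using key
  intro x hx
  have hGamma : Real.exp (f (x + 1 - 1)) = Real.Gamma (x + 1) := by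
    refine Real.eq_Gamma_of_log_convex (f := fun y => Real.exp (f (y - 1))) ?_ ?_ ?_ ?_
      (Set.mem_Ioi.2 (by linarith))
    · simpa only [Function.comp_def, Real.log_exp] using hgconv
    · intro y hy
      rw [hg y hy, Real.exp_add, Real.exp_log hy, mul_comm]
    · intro y _
      exact Real.exp_pos _
    · have h1 := hrec 1 one_pos
      rw [hinit, Real.log_one, zero_add] at h1
      simp only [← h1, Real.exp_zero]
  rw [← hGamma, Real.log_exp, add_sub_cancel_right]
end

section
/- Let a ∈ ℝ and let g : ℝ → ℝ be twice differentiable on [a, ∞) with g′(x) → 0 as x → ∞, and suppose there exists x₀ ≥ a such that either g′(x) ≥ 0 and g″(x) ≤ 0 for all x ≥ x₀, or g′(x) ≤ 0 and g″(x) ≥ 0 for all x ≥ x₀. Then there exists a function F : [a−1, ∞) → ℝ such that: (1) for every real x ≥ a−1, the sequence s ↦ (x−a+1)·g(a+s) + ∑_{k=0}^{s} ( g(a+k) − g(x+1+k) ) (s ∈ ℕ) converges to F(x); (2) F(a−1) = 0; (3) F(x) = g(x) + F(x−1) for all x ≥ a; (4) F(a+n) = ∑_{k=0}^{n} g(a+k)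 for every n ∈ ℕ. -/
open Filter Finset

/-- Mean value bounds for a function whose derivative is antitone on `[x₀, ∞)`. -/
theorem deriv_mul_le_sub_and_sub_le_deriv_mul {g : ℝ → ℝ} {x₀ : ℝ}
    (hg : ∀ x, x₀ ≤ x → DifferentiableAt ℝ g x) (hanti : AntitoneOn (deriv g) (Set.Ici x₀))
    {p q : ℝ} (hp : x₀ ≤ p) (hpq : p ≤ q) :
    deriv g q * (q - p) ≤ g q - g p ∧ g q - g p ≤ deriv g p * (q - p) := by
  have hcont : ContinuousOn g (Set.Icc p q) := fun x hx =>
    (hg x (hp.trans hx.1)).continuousAt.continuousWithinAt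
  have hdiff : DifferentiableOn ℝ g (interior (Set.Icc p q)) := fun x hx =>
    (hg x (hp.trans (interior_subset hx).1)).differentiableWithinAt
  constructor
  · refine (convex_Icc p q).mul_sub_le_image_sub_of_le_deriv hcont hdiff (fun x hx => ?_)
      p (Set.left_mem_Icc.2 hpq) q (Set.right_mem_Icc.2 hpq) hpq
    have hx' := interior_subset hx
    exact hanti (hp.trans hx'.1) (hp.trans hpq) hx'.2
  · refine (convex_Icc p q).image_sub_le_mul_sub_of_deriv_le hcont hdiff (fun x hx => ?_)
      p (Set.left_mem_Icc.2 hpq) q (Set.right_mem_Icc.2 hpq) hpq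
    have hx' := interior_subset hx
    exact hanti hp (hp.trans hx'.1) hx'.1

/-- A sequence that is eventually monotone and lies below an eventually antitone sequence
converges. -/
theorem exists_tendsto_of_le_succ_of_succ_le {u v : ℕ → ℝ} {K : ℕ}
    (hu : ∀ s, K ≤ s → u s ≤ u (s + 1)) (hv : ∀ s, K ≤ s → v (s + 1) ≤ v s)
    (huv : ∀ s, K ≤ s → u s ≤ v s) : ∃ l, Tendsto u atTop (nhds l) := by
  have hmono : Monotone fun s => u (s + K) := monotone_nat_of_le_succ fun s => by
    simpa [add_right_comm] using hu (s + K) (Nat.le_add_left K s)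
  have hanti : Antitone fun s => v (s + K) := antitone_nat_of_succ_le fun s => by
    simpa [add_right_comm] using hv (s + K) (Nat.le_add_left K s)
  have hbdd : BddAbove (Set.range fun s => u (s + K)) := by
    refine ⟨v (0 + K), ?_⟩
    rintro _ ⟨s, rfl⟩
    exact (huv _ (Nat.le_add_left K s)).trans (hanti (Nat.zero_le s))
  exact ⟨_, (tendsto_add_atTop_iff_nat K).1 (tendsto_atTop_ciSup hmono hbdd)⟩

/-- If `g` has an antitone nonnegative derivative on `[x₀, ∞)`, then the sequence defining the
generalized sum of `g` converges. -/
theorem exists_tendsto_generalizedSum {g : ℝ → ℝ} {x₀ : ℝ} (a : ℝ)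
    (hg : ∀ x, x₀ ≤ x → DifferentiableAt ℝ g x) (hanti : AntitoneOn (deriv g) (Set.Ici x₀))
    (hnonneg : ∀ x, x₀ ≤ x → 0 ≤ deriv g x) {x : ℝ} (hx : a - 1 ≤ x) :
    ∃ l, Tendsto (fun s : ℕ =>
      (x - a + 1) * g (a + s) + ∑ k ∈ Finset.range (s + 1), (g (a + k) - g (x + 1 + k)))
      atTop (nhds l) := by
  obtain ⟨K, hK⟩ := exists_nat_ge (x₀ - a)
  obtain ⟨N, hN⟩ := exists_nat_ge (x - a + 2)
  set u : ℕ → ℝ := fun s =>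
    (x - a + 1) * g (a + s) + ∑ k ∈ Finset.range (s + 1), (g (a + k) - g (x + 1 + k)) with hu
  set H : ℕ → ℝ := fun s => ∑ j ∈ Finset.range N, deriv g (a + (s + j : ℕ)) with hH
  have ht : 0 ≤ x - a + 1 := by linarith
  have hustep (s : ℕ) : u (s + 1) - u s = (x - a + 1) * (g (a + s + 1) - g (a + s))
      - (g (x + 2 + s) - g (a + s + 1)) := by
    simp only [hu]
    rw [Finset.sum_range_succ _ (s + 1)]
    push_cast
    rw [show x + 1 + ((s : ℝ) + 1) = x + 2 + s by ring,
      show a + ((s : ℝ) + 1) = a + s + 1 by ring]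
    ring
  have hHstep (s : ℕ) : H s - H (s + 1) = deriv g (a + s) - deriv g (a + s + N) := by
    have h1 := Finset.sum_range_succ (fun j : ℕ => deriv g (a + (s + j : ℕ))) N
    have h2 := Finset.sum_range_succ' (fun j : ℕ => deriv g (a + (s + j : ℕ))) N
    have h3 : H (s + 1) = ∑ j ∈ Finset.range N, deriv g (a + (s + (j + 1) : ℕ)) := by
      simp only [hH]
      refine Finset.sum_congr rfl fun j _ => ?_
      rw [show s + 1 + j = s + (j + 1) by omega]
    rw [h3]
    simp only [hH]
    rw [h1] at h2
    have h4 : a + ((s + N : ℕ) : ℝ) = a + s + N := by push_cast; ring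
    rw [h4] at h2
    simp only [add_zero] at h2
    linarith
  have hbase (s : ℕ) (hs : K ≤ s) : x₀ ≤ a + s := by
    have : (K : ℝ) ≤ s := by exact_mod_cast hs
    linarith
  refine exists_tendsto_of_le_succ_of_succ_le (u := u) (v := fun s => u s + (x - a + 1) * H s)
    (K := K) (fun s hs => ?_) (fun s hs => ?_) (fun s hs => ?_)
  · have hb := hbase s hs
    have h1 := (deriv_mul_le_sub_and_sub_le_deriv_mul hg hanti hb
      (by linarith : a + (s : ℝ) ≤ a + s + 1)).1
    have h2 := (deriv_mul_le_sub_and_sub_le_deriv_mul hg hanti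
      (by linarith : x₀ ≤ a + (s : ℝ) + 1) (by linarith : a + (s : ℝ) + 1 ≤ x + 2 + s)).2
    have h3 := mul_le_mul_of_nonneg_left h1 ht
    linarith [hustep s]
  · have hb := hbase s hs
    have h1 := (deriv_mul_le_sub_and_sub_le_deriv_mul hg hanti hb
      (by linarith : a + (s : ℝ) ≤ a + s + 1)).2
    have h2 := (deriv_mul_le_sub_and_sub_le_deriv_mul hg hanti
      (by linarith : x₀ ≤ a + (s : ℝ) + 1) (by linarith : a + (s : ℝ) + 1 ≤ x + 2 + s)).1
    have h3 := mul_le_mul_of_nonneg_left h1 ht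
    have h4 : deriv g (a + s + N) ≤ deriv g (x + 2 + s) :=
      hanti (show x₀ ≤ x + 2 + s by linarith) (show x₀ ≤ a + s + N by linarith) (by linarith)
    have h5 := mul_le_mul_of_nonneg_left h4 ht
    have h6 := congrArg (fun z => (x - a + 1) * z) (hHstep s)
    linarith [hustep s]
  · have hH0 : 0 ≤ H s := Finset.sum_nonneg fun j _ => hnonneg _ (hbase _ (by omega))
    have := mul_nonneg ht hH0
    linarith

/-- If `g` has an antitone derivative on `[x₀, ∞)` tending to `0`, then bounded-gap differences of
`g` along `ℕ`-translates tend to `0`. -/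
theorem tendsto_sub_of_antitoneOn_deriv {g : ℝ → ℝ} {x₀ : ℝ}
    (hg : ∀ x, x₀ ≤ x → DifferentiableAt ℝ g x) (hanti : AntitoneOn (deriv g) (Set.Ici x₀))
    (hlim : Tendsto (deriv g) atTop (nhds 0)) {p q : ℝ} (hpq : p ≤ q) :
    Tendsto (fun s : ℕ => g (q + s) - g (p + s)) atTop (nhds 0) := by
  have htop (r : ℝ) : Tendsto (fun s : ℕ => r + (s : ℝ)) atTop atTop :=
    tendsto_atTop_add_const_left _ r tendsto_natCast_atTop_atTop
  have hd (r : ℝ) : Tendsto (fun s : ℕ => deriv g (r + s) * (q - p)) atTop (nhds 0) := by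
    simpa using (hlim.comp (htop r)).mul_const (q - p)
  have hev : ∀ᶠ s : ℕ in atTop, x₀ ≤ p + s := (htop p).eventually_ge_atTop x₀
  refine tendsto_of_tendsto_of_tendsto_of_le_of_le' (hd q) (hd p) ?_ ?_
  · filter_upwards [hev] with s hs
    simpa using (deriv_mul_le_sub_and_sub_le_deriv_mul hg hanti hs
      (by linarith : p + (s : ℝ) ≤ q + s)).1
  · filter_upwards [hev] with s hs
    simpa using (deriv_mul_le_sub_and_sub_le_deriv_mul hg hanti hs
      (by linarith : p + (s : ℝ) ≤ q + s)).2

theorem antitoneOn_Ici_of_deriv_nonpos {f : ℝ → ℝ} {x₀ : ℝ}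
    (hf : ∀ x, x₀ ≤ x → DifferentiableAt ℝ f x) (hf' : ∀ x, x₀ ≤ x → deriv f x ≤ 0) :
    AntitoneOn f (Set.Ici x₀) :=
  antitoneOn_of_deriv_nonpos (convex_Ici x₀)
    (fun x hx => (hf x hx).continuousAt.continuousWithinAt)
    (fun x hx => (hf x (interior_subset hx)).differentiableWithinAt)
    (fun x hx => hf' x (interior_subset hx))

/-- Evaluation of the natural generalization of a semi-linear simple finite sum: if `g` is
nearly convergent on `[a, ∞)`, then there is a function `F` on `[a-1, ∞)` given by the limit
`F(x) = lim_{s→∞} ((x-a+1)·g(a+s) + ∑_{k=0}^{s} (g(a+k) − g(x+1+k)))` which satisfies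
`F(a-1) = 0`, the recurrence `F(x) = g(x) + F(x-1)` for `x ≥ a`, and agrees with the finite sum
`∑_{k=0}^{n} g(a+k)` at `x = a + n`. -/
theorem stmt_3 (a : ℝ) (g : ℝ → ℝ)
    (hg : ∀ x ∈ Set.Ici a, DifferentiableAt ℝ g x)
    (hg' : ∀ x ∈ Set.Ici a, DifferentiableAt ℝ (deriv g) x)
    (hlim : Tendsto (deriv g) atTop (nhds 0))
    (hshape : ∃ x₀ : ℝ, a ≤ x₀ ∧
      ((∀ x, x₀ ≤ x → 0 ≤ deriv g x ∧ deriv (deriv g) x ≤ 0) ∨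
       (∀ x, x₀ ≤ x → deriv g x ≤ 0 ∧ 0 ≤ deriv (deriv g) x))) :
    ∃ F : ℝ → ℝ,
      (∀ x : ℝ, a - 1 ≤ x →
        Tendsto (fun s : ℕ =>
            (x - a + 1) * g (a + s) + ∑ k ∈ Finset.range (s + 1), (g (a + k) - g (x + 1 + k)))
          atTop (nhds (F x))) ∧
      F (a - 1) = 0 ∧
      (∀ x : ℝ, a ≤ x → F x = g x + F (x - 1)) ∧
      (∀ n : ℕ, F (a + n) = ∑ k ∈ Finset.range (n + 1), g (a + k)) := by
  have key : (∀ x, a - 1 ≤ x → ∃ l, Tendsto (fun s : ℕ =>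
        (x - a + 1) * g (a + s) + ∑ k ∈ Finset.range (s + 1), (g (a + k) - g (x + 1 + k)))
        atTop (nhds l)) ∧
      ∀ x, a - 1 ≤ x → Tendsto (fun s : ℕ => g (x + 1 + s) - g (a + s)) atTop (nhds 0) := by
    obtain ⟨x₀, hx₀, h | h⟩ := hshape
    · have hd : ∀ x, x₀ ≤ x → DifferentiableAt ℝ g x := fun x hx => hg x (hx₀.trans hx)
      have hanti : AntitoneOn (deriv g) (Set.Ici x₀) := antitoneOn_Ici_of_deriv_nonpos
        (fun x hx => hg' x (hx₀.trans hx)) (fun x hx => (h x hx).2)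
      exact ⟨fun x hx => exists_tendsto_generalizedSum a hd hanti (fun y hy => (h y hy).1) hx,
        fun x hx => tendsto_sub_of_antitoneOn_deriv hd hanti hlim (by linarith)⟩
    · have hneg : deriv (-g) = -deriv g := deriv.neg'
      have hd : ∀ x, x₀ ≤ x → DifferentiableAt ℝ (-g) x := fun x hx => (hg x (hx₀.trans hx)).neg
      have hanti : AntitoneOn (deriv (-g)) (Set.Ici x₀) := by
        rw [hneg]
        refine antitoneOn_Ici_of_deriv_nonpos (fun x hx => (hg' x (hx₀.trans hx)).neg)
          (fun x hx => ?_)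
        rw [deriv.neg]
        linarith [(h x hx).2]
      have hlim' : Tendsto (deriv (-g)) atTop (nhds 0) := by
        rw [hneg]
        exact neg_zero (G := ℝ) ▸ hlim.neg
      refine ⟨fun x hx => ?_, fun x hx => ?_⟩
      · obtain ⟨l, hl⟩ := exists_tendsto_generalizedSum a hd hanti
          (fun y hy => by rw [hneg, Pi.neg_apply]; linarith [(h y hy).1]) hx
        refine ⟨-l, hl.neg.congr fun s => ?_⟩
        rw [neg_add, ← Finset.sum_neg_distrib]
        simp only [Pi.neg_apply]
        congr 1
        · ring
        · exact Finset.sum_congr rfl fun k _ => by ring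
      · have := (tendsto_sub_of_antitoneOn_deriv hd hanti hlim'
          (by linarith : a ≤ x + 1)).neg
        rw [neg_zero] at this
        refine this.congr fun s => ?_
        simp only [Pi.neg_apply]
        ring
  obtain ⟨hconv, hgap⟩ := key
  choose! F hF using hconv
  have hzero : F (a - 1) = 0 := by
    refine tendsto_nhds_unique (hF (a - 1) le_rfl) (tendsto_const_nhds.congr fun s => ?_)
    simp
  have hrec : ∀ x : ℝ, a ≤ x → F x = g x + F (x - 1) := by
    intro x hx
    have h1 := (hF x (by linarith)).sub (hF (x - 1) (by linarith))
    have h2 : Tendsto (fun s : ℕ => g x - (g (x + 1 + s) - g (a + s))) atTop (nhds (g x)) := by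
      simpa using (hgap x (by linarith)).const_sub (g x)
    have h3 : F x - F (x - 1) = g x := by
      refine tendsto_nhds_unique h1 (h2.congr fun s => ?_)
      have h4 := Finset.sum_range_sub (fun k : ℕ => g (x + k)) (s + 1)
      rw [Finset.sum_sub_distrib] at h4
      simp only [Finset.sum_sub_distrib, sub_add_cancel]
      have h5 : ∀ k : ℕ, g (x + 1 + k) = g (x + (k + 1 : ℕ)) := fun k => by
        congr 1
        push_cast
        ring
      simp only [h5]
      simp only [Nat.cast_zero, add_zero] at h4
      linarith
    linarith
  refine ⟨F, hF, hzero, hrec, fun n => ?_⟩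
  induction n with
  | zero => simpa [hzero] using hrec a le_rfl
  | succ n ih =>
    rw [Finset.sum_range_succ, ← ih, hrec _ (by simpa using (by positivity : (0 : ℝ) ≤ n + 1)),
      show a + ((n + 1 : ℕ) : ℝ) - 1 = a + n by push_cast; ring]
    ring
end

section
/- Let n ≥ 1 be an integer, let (a_k)_{k≥0} be real numbers, and for 0 ≤ j ≤ n set χ_n(j) = n! / (n^j · (n−j)!) and s_j = ∑_{i=0}^{j} a_i. Then ∑_{k=0}^{n} χ_n(k) a_k = (1/n) · ∑_{k=0}^{n} k · χ_n(k) · s_k. -/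
open Finset

/-- Abel summation: a weighted sum in terms of the partial sums and the weight differences. -/
theorem sum_mul_eq_sum_sub_mul_partialSum {R : Type*} [CommRing R] (c a : ℕ → R) (m : ℕ) :
    ∑ k ∈ Finset.range m, c k * a k
      = ∑ k ∈ Finset.range m, (c k - c (k + 1)) * ∑ i ∈ Finset.range (k + 1), a i
        + c m * ∑ i ∈ Finset.range m, a i := by
  induction m with
  | zero => simp
  | succ m ih =>
    rw [Finset.sum_range_succ, ih, Finset.sum_range_succ _ m, Finset.sum_range_succ a m]
    ring

/-- The weights `χ_n(k) = n!/(n^k (n-k)!)` satisfy `χ_n(k) - χ_n(k+1) = k χ_n(k) / n`. -/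
theorem chi_sub_chi_succ {n k : ℕ} (hk : k < n) :
    (n.factorial : ℝ) / ((n : ℝ) ^ k * ((n - k).factorial : ℝ))
        - (n.factorial : ℝ) / ((n : ℝ) ^ (k + 1) * ((n - (k + 1)).factorial : ℝ))
      = 1 / (n : ℝ) * ((k : ℝ) * ((n.factorial : ℝ) / ((n : ℝ) ^ k * ((n - k).factorial : ℝ)))) := by
  obtain ⟨d, rfl⟩ := Nat.exists_eq_add_of_lt hk
  have hn : ((k + d + 1 : ℕ) : ℝ) ≠ 0 := by positivity
  have hd : (d.factorial : ℝ) ≠ 0 := by positivity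
  have hd' : (d : ℝ) + 1 ≠ 0 := by positivity
  have h₁ : k + d + 1 - k = d + 1 := by omega
  have h₂ : k + d + 1 - (k + 1) = d := by omega
  rw [h₁, h₂, Nat.factorial_succ d, Nat.cast_mul, Nat.cast_succ d]
  field_simp
  push_cast
  ring

/-- The summability method Ξ expressed as a weighted average of partial sums: for `n ≥ 1`,
`∑_{k=0}^{n} χ_n(k) a_k = (1/n) ∑_{k=0}^{n} k χ_n(k) s_k`, where
`χ_n(j) = n!/(n^j (n-j)!)` and `s_j = ∑_{i=0}^{j} a_i`. -/
theorem stmt_4 (n : ℕ) (hn : 1 ≤ n) (a : ℕ → ℝ) :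
    ∑ k ∈ Finset.range (n + 1), (n.factorial : ℝ) / ((n : ℝ) ^ k * ((n - k).factorial : ℝ)) * a k
      = (1 / (n : ℝ)) * ∑ k ∈ Finset.range (n + 1),
          (k : ℝ) * ((n.factorial : ℝ) / ((n : ℝ) ^ k * ((n - k).factorial : ℝ)))
            * (∑ i ∈ Finset.range (k + 1), a i) := by
  have hn' : (n : ℝ) ≠ 0 := by positivity
  rw [Finset.sum_range_succ,
    sum_mul_eq_sum_sub_mul_partialSum
      (fun k => (n.factorial : ℝ) / ((n : ℝ) ^ k * ((n - k).factorial : ℝ))) a n,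
    Finset.sum_congr rfl fun k hk => by rw [chi_sub_chi_succ (Finset.mem_range.mp hk), mul_assoc],
    ← Finset.mul_sum, Finset.sum_range_succ _ n, Finset.sum_range_succ a n, mul_add, add_assoc]
  congr 1
  field_simp
end

section
/- For every real x with −1 < x ≤ 1, the series ∑_{k=2}^{∞} (−1)^k ζ(k) x^k / k converges and log Γ(x+1) = −γ x + ∑_{k=2}^{∞} (−1)^k ζ(k) x^k / k. (In particular, taking x = 1 gives Euler's identity γ = ∑_{k=2}^{∞} (−1)^k ζ(k)/k.) -/
open Filter Finset

/-- The Riemann zeta function at integer arguments `s > 1`, as a real series `∑_{n≥1} n^{-s}`. -/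
noncomputable def zetaR (s : ℕ) : ℝ := ∑' n : ℕ, 1 / ((n : ℝ) + 1) ^ s

/-- The Mercator series converges to `log (1 + t)` for `-1 < t ≤ 1`. -/
theorem tendsto_sum_range_log_one_add {t : ℝ} (h₁ : -1 < t) (h₂ : t ≤ 1) :
    Tendsto (fun N : ℕ => ∑ k ∈ range N, (-1 : ℝ) ^ k * t ^ (k + 1) / ((k : ℝ) + 1))
      atTop (nhds (Real.log (1 + t))) := by
  have hlt : ∀ y : ℝ, |y| < 1 →
      HasSum (fun k : ℕ => (-1 : ℝ) ^ k * y ^ (k + 1) / ((k : ℝ) + 1)) (Real.log (1 + y)) := by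
    intro y hy
    have h := (Real.hasSum_pow_div_log_of_abs_lt_one (x := -y) (by rwa [abs_neg])).neg
    rw [neg_neg, sub_neg_eq_add] at h
    refine h.congr_fun fun k => ?_
    rw [neg_pow y, pow_succ (-1 : ℝ)]
    ring
  rcases h₂.lt_or_eq with h | rfl
  · exact (hlt t (abs_lt.2 ⟨h₁, h⟩)).tendsto_sum_nat
  · have hanti : Antitone fun k : ℕ => 1 / ((k : ℝ) + 1) := fun a b hab => by
      have : (a : ℝ) ≤ b := by exact_mod_cast hab
      exact one_div_le_one_div_of_le (by positivity) (by linarith)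
    obtain ⟨l, hl⟩ := hanti.tendsto_alternating_series_of_tendsto_zero
      tendsto_one_div_add_atTop_nhds_zero_nat
    have hid : Tendsto (fun y : ℝ => y) (nhdsWithin 1 (Set.Iio 1)) (nhds 1) :=
      tendsto_id.mono_left nhdsWithin_le_nhds
    have habel := hid.mul (Real.tendsto_tsum_powerSeries_nhdsWithin_lt hl)
    have hlog : Tendsto (fun y : ℝ => Real.log (1 + y)) (nhdsWithin 1 (Set.Iio 1))
        (nhds (Real.log (1 + 1))) :=
      (hid.const_add 1).log (by norm_num)
    have heq : l = Real.log (1 + 1) := by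
      refine tendsto_nhds_unique ?_ hlog
      rw [one_mul] at habel
      refine habel.congr' ?_
      filter_upwards [Ioo_mem_nhdsLT (show (0 : ℝ) < 1 by norm_num)] with y hy
      rw [← (hlt y (abs_lt.2 ⟨by linarith [hy.1], hy.2⟩)).tsum_eq, ← tsum_mul_left]
      exact tsum_congr fun k => by ring
    rw [← heq]
    refine hl.congr fun N => sum_congr rfl fun k _ => ?_
    rw [one_pow]
    ring

/-- The Mercator series without its linear term converges to `t - log (1 + t)`. -/
theorem tendsto_sum_range_sub_log_one_add {t : ℝ} (h₁ : -1 < t) (h₂ : t ≤ 1) :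
    Tendsto (fun N : ℕ => ∑ k ∈ range N, (-1 : ℝ) ^ (k + 2) * t ^ (k + 2) / ((k : ℝ) + 2))
      atTop (nhds (t - Real.log (1 + t))) := by
  have h := ((tendsto_add_atTop_iff_nat 1).2 (tendsto_sum_range_log_one_add h₁ h₂)).const_sub t
  refine h.congr fun N => ?_
  rw [sum_range_succ', sub_add_eq_sub_sub_swap]
  simp only [pow_zero, one_mul, zero_add, pow_one, Nat.cast_zero, div_one, sub_self, zero_sub,
    ← sum_neg_distrib]
  refine sum_congr rfl fun k _ => ?_
  push_cast
  ring

theorem abs_sum_range_alternating_pow_le {t : ℝ} (ht : |t| ≤ 1 / 2) (N : ℕ) :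
    |∑ k ∈ range N, (-1 : ℝ) ^ (k + 2) * t ^ (k + 2) / ((k : ℝ) + 2)| ≤ 2 * t ^ 2 := by
  calc |∑ k ∈ range N, (-1 : ℝ) ^ (k + 2) * t ^ (k + 2) / ((k : ℝ) + 2)|
      ≤ ∑ k ∈ range N, t ^ 2 * (1 / 2 : ℝ) ^ k := by
        refine (abs_sum_le_sum_abs _ _).trans (sum_le_sum fun k _ => ?_)
        rw [abs_div, abs_mul, abs_pow, abs_pow, abs_neg, abs_one, one_pow, one_mul,
          abs_of_pos (show (0 : ℝ) < k + 2 by positivity), pow_add, sq_abs, mul_comm]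
        refine (div_le_self (by positivity) ?_).trans ?_
        · linarith [(k.cast_nonneg : (0 : ℝ) ≤ k)]
        · gcongr
    _ ≤ t ^ 2 * 2 := by
        rw [← mul_sum]
        exact mul_le_mul_of_nonneg_left (sum_geometric_two_le N) (sq_nonneg t)
    _ = 2 * t ^ 2 := mul_comm _ _

/-- The Weierstrass product for the Gamma function, in logarithmic form. -/
theorem tendsto_sum_range_log_Gamma {x : ℝ} (hx : -1 < x) :
    Tendsto (fun N : ℕ => ∑ n ∈ range N, (x / ((n : ℝ) + 1) - Real.log (1 + x / ((n : ℝ) + 1))))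
      atTop (nhds (Real.eulerMascheroniConstant * x + Real.log (Real.Gamma (x + 1)))) := by
  rw [← tendsto_add_atTop_iff_nat 1]
  have hΓ := Real.BohrMollerup.tendsto_log_gamma (show 0 < x + 1 by linarith)
  have hγ := Real.tendsto_harmonic_sub_log.comp (tendsto_add_atTop_nat 1)
  have h := ((hγ.mul_const x).add hΓ).add (Real.tendsto_log_nat_add_one_sub_log.mul_const (x + 1))
  rw [zero_mul, add_zero] at h
  refine h.congr fun n => ?_
  have hharm : ∀ N : ℕ, ∑ k ∈ range N, x / ((k : ℝ) + 1) = harmonic N * x := by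
    intro N
    simp only [harmonic, Rat.cast_sum, sum_mul]
    refine sum_congr rfl fun k _ => ?_
    push_cast
    ring
  have hlog : ∀ N : ℕ, ∑ k ∈ range N, Real.log (1 + x / ((k : ℝ) + 1)) =
      ∑ k ∈ range N, Real.log (x + 1 + k) - Real.log (N.factorial) := by
    intro N
    induction N with
    | zero => simp
    | succ N ih =>
      have hN : (0 : ℝ) < N + 1 := by positivity
      have hxN : 0 < x + 1 + N := by linarith [(N.cast_nonneg : (0 : ℝ) ≤ N)]
      rw [sum_range_succ, sum_range_succ, ih, Nat.factorial_succ, Nat.cast_mul, Nat.cast_succ,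
        Real.log_mul hN.ne' (by exact_mod_cast N.factorial_ne_zero),
        show 1 + x / ((N : ℝ) + 1) = (x + 1 + N) / (N + 1) by field_simp; ring,
        Real.log_div hxN.ne' hN.ne']
      ring
  rw [sum_sub_distrib, hharm, hlog, Nat.factorial_succ, Nat.cast_mul, Nat.cast_succ,
    Real.log_mul (by positivity) (by exact_mod_cast n.factorial_ne_zero)]
  simp only [Function.comp_apply, Real.BohrMollerup.logGammaSeq]
  push_cast
  ring

theorem summable_one_div_nat_add_one_pow (k : ℕ) :
    Summable fun n : ℕ => 1 / ((n : ℝ) + 1) ^ (k + 2) := by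
  have h := (summable_nat_add_iff 1).2
    (Real.summable_one_div_nat_pow.2 (show 1 < k + 2 by omega))
  simpa using h

theorem zetaR_partial_sum_eq_tsum (x : ℝ) (N : ℕ) :
    ∑ k ∈ range N, (-1 : ℝ) ^ (k + 2) * zetaR (k + 2) * x ^ (k + 2) / ((k : ℝ) + 2) =
      ∑' n : ℕ, ∑ k ∈ range N,
        (-1 : ℝ) ^ (k + 2) * (x / ((n : ℝ) + 1)) ^ (k + 2) / ((k : ℝ) + 2) := by
  have hterm : ∀ k n : ℕ, (-1 : ℝ) ^ (k + 2) * (x / ((n : ℝ) + 1)) ^ (k + 2) / ((k : ℝ) + 2) =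
      (-1 : ℝ) ^ (k + 2) * x ^ (k + 2) / ((k : ℝ) + 2) * (1 / ((n : ℝ) + 1) ^ (k + 2)) := by
    intro k n
    rw [div_pow]
    ring
  simp only [hterm]
  rw [Summable.tsum_finsetSum fun k _ => (summable_one_div_nat_add_one_pow k).mul_left _]
  refine sum_congr rfl fun k _ => ?_
  rw [tsum_mul_left, zetaR]
  ring

/-- Taylor expansion of the log-Gamma (log-factorial) function: for `-1 < x ≤ 1`, the series
`∑_{k=2}^{∞} (-1)^k ζ(k) x^k / k` converges and
`log Γ(x+1) = -γ x + ∑_{k=2}^{∞} (-1)^k ζ(k) x^k / k`. -/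
theorem stmt_6 (x : ℝ) (hx1 : -1 < x) (hx2 : x ≤ 1) :
    ∃ S : ℝ,
      Tendsto (fun N : ℕ => ∑ k ∈ Finset.range N,
          (-1 : ℝ) ^ (k + 2) * zetaR (k + 2) * x ^ (k + 2) / ((k : ℝ) + 2))
        atTop (nhds S) ∧
      Real.log (Real.Gamma (x + 1)) = -Real.eulerMascheroniConstant * x + S := by
  have harg : ∀ n : ℕ, -1 < x / ((n : ℝ) + 1) ∧ x / ((n : ℝ) + 1) ≤ 1 := by
    intro n
    have hn : (0 : ℝ) ≤ n := n.cast_nonneg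
    constructor
    · rw [lt_div_iff₀ (by positivity)]
      linarith
    · rw [div_le_one (by positivity)]
      linarith
  set P : ℕ → ℕ → ℝ := fun N n => ∑ k ∈ range N,
    (-1 : ℝ) ^ (k + 2) * (x / ((n : ℝ) + 1)) ^ (k + 2) / ((k : ℝ) + 2)
  have hlim : ∀ n, Tendsto (P · n) atTop
      (nhds (x / ((n : ℝ) + 1) - Real.log (1 + x / ((n : ℝ) + 1)))) :=
    fun n => tendsto_sum_range_sub_log_one_add (harg n).1 (harg n).2
  obtain ⟨C, hC⟩ := (hlim 0).abs.bddAbove_range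
  have hC' : ∀ N, |P N 0| ≤ C := fun N => hC ⟨N, rfl⟩
  have hC0 : 0 ≤ C := (abs_nonneg _).trans (hC' 0)
  have hbound : ∀ N n, ‖P N n‖ ≤ (C + 2) * (1 / ((n : ℝ) + 1) ^ (0 + 2)) := by
    intro N n
    rw [Real.norm_eq_abs]
    rcases Nat.eq_zero_or_pos n with rfl | hn
    · refine (hC' N).trans ?_
      norm_num
    · have hn1 : (1 : ℝ) ≤ n := by exact_mod_cast hn
      have hx : |x| ≤ 1 := abs_le.2 ⟨hx1.le, hx2⟩
      have hsmall : |x / ((n : ℝ) + 1)| ≤ 1 / 2 := by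
        rw [abs_div, abs_of_pos (show (0 : ℝ) < n + 1 by positivity),
          div_le_div_iff₀ (by positivity) (by norm_num)]
        linarith
      refine (abs_sum_range_alternating_pow_le hsmall N).trans ?_
      rw [div_pow, zero_add, div_eq_mul_one_div, ← mul_assoc]
      gcongr
      nlinarith [(sq_le_one_iff_abs_le_one x).2 hx]
  have hsummable := (summable_one_div_nat_add_one_pow 0).mul_left (C + 2)
  have hsum : Summable fun n : ℕ => x / ((n : ℝ) + 1) - Real.log (1 + x / ((n : ℝ) + 1)) :=
    hsummable.of_norm_bounded fun n => le_of_tendsto (hlim n).norm (.of_forall (hbound · n))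
  refine ⟨_, (tendsto_tsum_of_dominated_convergence hsummable hlim
    (.of_forall hbound)).congr fun N => (zetaR_partial_sum_eq_tsum x N).symm, ?_⟩
  rw [tendsto_nhds_unique hsum.hasSum.tendsto_sum_nat (tendsto_sum_range_log_Gamma hx1)]
  ring
end

section
/- For every integer m ≥ 0, log(1+m) = ( H_m − γ ) + ∑_{k=2}^{∞} (−1)^k ( ζ(k) − H_{k,m} ) / k, where the series on the right converges. (The case m = 0 recovers γ = ∑_{k=2}^{∞} (−1)^k ζ(k)/k, and m = 1 gives log 2 = 1 − γ + ∑_{k=2}^{∞} (−1)^k (ζ(k)−1)/k.) -/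
open Filter Finset

/-- The generalized harmonic number `H_{k,m} = ∑_{j=1}^{m} j^{-k}`. -/
noncomputable def Hgen (k m : ℕ) : ℝ := ∑ j ∈ Finset.range m, 1 / ((j : ℝ) + 1) ^ k

/-- The harmonic number `H_m = ∑_{j=1}^{m} 1/j`. -/
noncomputable def H (m : ℕ) : ℝ := ∑ j ∈ Finset.range m, 1 / ((j : ℝ) + 1)

/-- The alternating Taylor polynomials of `x - log (1 + x)` approximate it on `[0, 1]` with an error
bounded by the first omitted term. -/
theorem abs_alternating_sum_sub_le {x : ℝ} (hx : x ∈ Set.Icc (0 : ℝ) 1) (N : ℕ) :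
    |∑ k ∈ Finset.range N, (-1 : ℝ) ^ (k + 2) * x ^ (k + 2) / ((k : ℝ) + 2)
      - (x - Real.log (1 + x))| ≤ x ^ (N + 2) / ((N : ℝ) + 2) := by
  have monomial_deriv (k : ℕ) (y : ℝ) :
      HasDerivAt (fun z : ℝ => z ^ (k + 2) / ((k : ℝ) + 2)) (y ^ (k + 1)) y := by
    convert! (hasDerivAt_pow (k + 2) y).div_const ((k : ℝ) + 2) using 1
    have : (k : ℝ) + 2 ≠ 0 := by positivity
    push_cast
    field_simp
  have error_deriv (y : ℝ) (hy : 0 ≤ y) : HasDerivAt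
      (fun z : ℝ => ∑ k ∈ Finset.range N, (-1 : ℝ) ^ (k + 2) * z ^ (k + 2) / ((k : ℝ) + 2)
        - (z - Real.log (1 + z)))
      (∑ k ∈ Finset.range N, (-1 : ℝ) ^ (k + 2) * y ^ (k + 1) - (1 - 1 / (1 + y))) y := by
    refine HasDerivAt.sub (HasDerivAt.fun_sum fun k _ => ?_) ((hasDerivAt_id y).sub ?_)
    · simpa only [mul_div_assoc] using (monomial_deriv k y).const_mul ((-1 : ℝ) ^ (k + 2))
    · exact ((hasDerivAt_id y).const_add 1).log (by simp only [id]; positivity)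
  have deriv_eq (y : ℝ) (hy : 0 ≤ y) :
      ∑ k ∈ Finset.range N, (-1 : ℝ) ^ (k + 2) * y ^ (k + 1) - (1 - 1 / (1 + y))
        = -((-1) ^ N * y ^ (N + 1) / (1 + y)) := by
    have hne : 1 + y ≠ 0 := by positivity
    clear error_deriv
    induction N with
    | zero => simp; field_simp; ring
    | succ n ih =>
      rw [Finset.sum_range_succ, add_sub_right_comm, ih]
      field_simp
      ring
  have := image_norm_le_of_norm_deriv_right_le_deriv_boundary (a := 0) (b := 1)
    (B := fun z : ℝ => z ^ (N + 2) / ((N : ℝ) + 2)) (B' := fun z => z ^ (N + 1))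
    (fun y hy => (error_deriv y hy.1).continuousAt.continuousWithinAt)
    (fun y hy => (error_deriv y hy.1).hasDerivWithinAt)
    (by simp) (monomial_deriv N) (fun y hy => by
      have hy0 : 0 ≤ y := hy.1
      rw [deriv_eq y hy0, Real.norm_eq_abs, abs_neg, abs_div, abs_mul, abs_pow, abs_neg, abs_one,
        one_pow, one_mul, abs_of_nonneg (by positivity : (0 : ℝ) ≤ y ^ (N + 1)),
        abs_of_nonneg (by positivity : (0 : ℝ) ≤ 1 + y)]
      exact div_le_self (by positivity) (by linarith)) hx
  simpa using this

theorem harmonic_eq_H (n : ℕ) : (harmonic n : ℝ) = H n := by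
  simp [harmonic, H]

theorem summable_one_div_nat_add_pow (m k : ℕ) :
    Summable fun n : ℕ => (1 / ((n : ℝ) + m + 1)) ^ (k + 2) := by
  have := (summable_nat_add_iff (m + 1)).2
    (Real.summable_one_div_nat_pow.2 (by omega : 1 < k + 2))
  refine this.congr fun n => ?_
  rw [one_div_pow]
  push_cast
  ring_nf

theorem zetaR_sub_Hgen (m k : ℕ) :
    zetaR (k + 2) - Hgen (k + 2) m = ∑' n : ℕ, (1 / ((n : ℝ) + m + 1)) ^ (k + 2) := by
  have hs : Summable fun n : ℕ => 1 / ((n : ℝ) + 1) ^ (k + 2) := by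
    simpa using summable_one_div_nat_add_pow 0 k
  rw [zetaR, Hgen, ← hs.sum_add_tsum_nat_add m, add_sub_cancel_left]
  simp

theorem hasSum_one_div_sub_log (m : ℕ) :
    HasSum (fun n : ℕ => 1 / ((n : ℝ) + m + 1) - Real.log (1 + 1 / ((n : ℝ) + m + 1)))
      (Real.eulerMascheroniConstant - H m + Real.log (1 + (m : ℝ))) := by
  rw [hasSum_iff_tendsto_nat_of_nonneg]
  · have partial_sum (M : ℕ) :
        ∑ n ∈ Finset.range M, (1 / ((n : ℝ) + m + 1) - Real.log (1 + 1 / ((n : ℝ) + m + 1)))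
          = ((harmonic (M + m) : ℝ) - Real.log ((M + m : ℕ) + 1)) - H m
            + Real.log (1 + (m : ℝ)) := by
      induction M with
      | zero => simp [harmonic_eq_H, add_comm]
      | succ M ih =>
        have hpos : (0 : ℝ) < (M : ℝ) + m + 1 := by positivity
        have hlog : Real.log (1 + 1 / ((M : ℝ) + m + 1))
            = Real.log ((M : ℝ) + m + 2) - Real.log ((M : ℝ) + m + 1) := by
          rw [← Real.log_div (by positivity) hpos.ne']
          congr 1
          field_simp
          ring
        rw [Finset.sum_range_succ, ih, hlog, show M + 1 + m = (M + m) + 1 by ring, harmonic_succ]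
        push_cast
        rw [show (M : ℝ) + m + 1 + 1 = M + m + 2 by ring, one_div]
        ring
    simp_rw [partial_sum]
    exact ((Real.tendsto_harmonic_sub_log_add_one.comp (tendsto_add_atTop_nat m)).sub_const
      _).add_const _
  · intro n
    have hpos : (0 : ℝ) < 1 + 1 / ((n : ℝ) + m + 1) := by positivity
    linarith [Real.log_le_sub_one_of_pos hpos]

/-- For every integer `m ≥ 0`, the series `∑_{k=2}^{∞} (-1)^k (ζ(k) − H_{k,m})/k` converges and
`log(1+m) = (H_m − γ) + ∑_{k=2}^{∞} (-1)^k (ζ(k) − H_{k,m})/k`. -/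
theorem stmt_7 (m : ℕ) :
    ∃ S : ℝ,
      Tendsto (fun N : ℕ => ∑ k ∈ Finset.range N,
          (-1 : ℝ) ^ (k + 2) * (zetaR (k + 2) - Hgen (k + 2) m) / ((k : ℝ) + 2))
        atTop (nhds S) ∧
      Real.log (1 + (m : ℝ)) = (H m - Real.eulerMascheroniConstant) + S := by
  refine ⟨Real.eulerMascheroniConstant - H m + Real.log (1 + (m : ℝ)), ?_, by ring⟩
  have partial_hasSum (N : ℕ) := hasSum_sum (s := Finset.range N) fun k _ =>
    ((summable_one_div_nat_add_pow m k).hasSum.mul_left ((-1 : ℝ) ^ (k + 2))).div_const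
      ((k : ℝ) + 2)
  simp_rw [zetaR_sub_Hgen]
  rw [tendsto_iff_norm_sub_tendsto_zero]
  have bound_tendsto : Tendsto
      (fun N : ℕ => (∑' n : ℕ, (1 / ((n : ℝ) + m + 1)) ^ 2) / ((N : ℝ) + 2)) atTop (nhds 0) :=
    tendsto_const_nhds.div_atTop (tendsto_natCast_atTop_atTop.atTop_add tendsto_const_nhds)
  refine squeeze_zero (fun _ => norm_nonneg _) (fun N => ?_) bound_tendsto
  have error_hasSum := (partial_hasSum N).sub (hasSum_one_div_sub_log m)
  rw [← error_hasSum.tsum_eq]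
  refine tsum_of_norm_bounded
    ((summable_one_div_nat_add_pow m 0).hasSum.div_const ((N : ℝ) + 2)) fun n => ?_
  have hx0 : 0 ≤ 1 / ((n : ℝ) + m + 1) := by positivity
  have hx1 : 1 / ((n : ℝ) + m + 1) ≤ 1 :=
    div_le_one_of_le₀ (by linarith [n.cast_nonneg (α := ℝ), m.cast_nonneg (α := ℝ)])
      (by positivity)
  refine (abs_alternating_sum_sub_le ⟨hx0, hx1⟩ N).trans ?_
  gcongr ?_ / _
  exact pow_le_pow_of_le_one hx0 hx1 (by omega)
end

section
/- The series ∑_{k=1}^{∞} ζ(2k+1) / ( 4^k (2k+1) ) converges and γ + ∑_{k=1}^{∞} ζ(2k+1) / ( 4^k (2k+1) ) = log 2. -/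
open Filter Finset

/-- The general term of the double series `∑ₙ ∑ₖ 2 xₙ ^ (2k+3) / (2k+3)` with `xₙ = 1 / (2(n+1))`. -/
noncomputable def zetaDoubleTerm (n k : ℕ) : ℝ :=
  1 / ((n : ℝ) + 1) ^ (2 * (k + 1) + 1) / ((4 : ℝ) ^ (k + 1) * (2 * ((k : ℝ) + 1) + 1))

lemma zetaDoubleTerm_nonneg (n k : ℕ) : 0 ≤ zetaDoubleTerm n k := by
  unfold zetaDoubleTerm
  positivity

lemma hasSum_zetaDoubleTerm_left (n : ℕ) :
    HasSum (zetaDoubleTerm n)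
      (Real.log (2 * ((n + 1 : ℕ) : ℝ) + 1) - Real.log (2 * (n : ℝ) + 1) - ((n : ℝ) + 1)⁻¹) := by
  have hn : (0 : ℝ) ≤ n := n.cast_nonneg
  have hx0 : (0 : ℝ) < 1 / (2 * ((n : ℝ) + 1)) := by positivity
  have hx1 : 1 / (2 * ((n : ℝ) + 1)) < 1 := by
    rw [div_lt_one (by positivity)]
    linarith
  have h := Real.hasSum_log_sub_log_of_abs_lt_one (abs_lt.2 ⟨by linarith, hx1⟩)
  have h' := (hasSum_nat_add_iff' 1).2 h
  convert! h' using 1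
  · funext k
    have h4 : (4 : ℝ) ^ (k + 1) = 2 ^ (2 * (k + 1)) := by rw [pow_mul]; norm_num
    rw [zetaDoubleTerm, h4, div_pow, mul_pow, one_pow, pow_succ (2 : ℝ) (2 * (k + 1))]
    push_cast
    field_simp
  · have e1 : 1 + 1 / (2 * ((n : ℝ) + 1)) = (2 * ((n + 1 : ℕ) : ℝ) + 1) / (2 * ((n : ℝ) + 1)) := by
      push_cast
      field_simp
    have e2 : 1 - 1 / (2 * ((n : ℝ) + 1)) = (2 * (n : ℝ) + 1) / (2 * ((n : ℝ) + 1)) := by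
      field_simp
      ring
    rw [e1, e2, Real.log_div (by positivity) (by positivity),
      Real.log_div (by positivity) (by positivity)]
    simp
    ring

lemma sum_range_log_sub_inv (N : ℕ) :
    ∑ n ∈ Finset.range N,
      (Real.log (2 * ((n + 1 : ℕ) : ℝ) + 1) - Real.log (2 * (n : ℝ) + 1) - ((n : ℝ) + 1)⁻¹) =
      Real.log (2 * (N : ℝ) + 1) - harmonic N := by
  rw [Finset.sum_sub_distrib, Finset.sum_range_sub (fun n : ℕ => Real.log (2 * (n : ℝ) + 1))]
  simp [harmonic]

lemma tendsto_log_two_mul_add_one_sub_harmonic :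
    Tendsto (fun N : ℕ => Real.log (2 * (N : ℝ) + 1) - harmonic N) atTop
      (nhds (Real.log 2 - Real.eulerMascheroniConstant)) := by
  have h0 : Tendsto (fun N : ℕ => 2 + 1 / (N : ℝ)) atTop (nhds 2) := by
    simpa using tendsto_one_div_atTop_nhds_zero_nat.const_add (2 : ℝ)
  refine ((h0.log two_ne_zero).sub Real.tendsto_harmonic_sub_log).congr' ?_
  filter_upwards [eventually_gt_atTop 0] with N hN
  have hN' : (0 : ℝ) < N := Nat.cast_pos.2 hN
  have e : 2 * (N : ℝ) + 1 = (2 + 1 / (N : ℝ)) * N := by field_simp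
  rw [e, Real.log_mul (by positivity) hN'.ne']
  ring

lemma hasSum_tsum_zetaDoubleTerm :
    HasSum (fun n => ∑' k, zetaDoubleTerm n k) (Real.log 2 - Real.eulerMascheroniConstant) := by
  rw [hasSum_iff_tendsto_nat_of_nonneg fun n => tsum_nonneg (zetaDoubleTerm_nonneg n)]
  simp_rw [(hasSum_zetaDoubleTerm_left _).tsum_eq, sum_range_log_sub_inv]
  exact tendsto_log_two_mul_add_one_sub_harmonic

lemma summable_zetaDoubleTerm :
    Summable (fun p : ℕ × ℕ => zetaDoubleTerm p.1 p.2) :=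
  (summable_prod_of_nonneg fun p => zetaDoubleTerm_nonneg p.1 p.2).2
    ⟨fun n => (hasSum_zetaDoubleTerm_left n).summable, hasSum_tsum_zetaDoubleTerm.summable⟩

lemma hasSum_zetaR_div :
    HasSum (fun k : ℕ =>
        zetaR (2 * (k + 1) + 1) / ((4 : ℝ) ^ (k + 1) * (2 * ((k : ℝ) + 1) + 1)))
      (Real.log 2 - Real.eulerMascheroniConstant) := by
  have hz (k : ℕ) : zetaR (2 * (k + 1) + 1) / ((4 : ℝ) ^ (k + 1) * (2 * ((k : ℝ) + 1) + 1)) =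
      ∑' n, zetaDoubleTerm n k := by
    simp_rw [zetaDoubleTerm, zetaR, tsum_div_const]
  have hs : Summable (fun p : ℕ × ℕ => zetaDoubleTerm p.2 p.1) := summable_zetaDoubleTerm.prod_symm
  have hc := Summable.tsum_comm (f := zetaDoubleTerm) summable_zetaDoubleTerm
  rw [funext hz, ← hasSum_tsum_zetaDoubleTerm.tsum_eq, ← hc]
  exact hs.prod.hasSum

/-- The series `∑_{k=1}^{∞} ζ(2k+1)/(4^k (2k+1))` converges and
`γ + ∑_{k=1}^{∞} ζ(2k+1)/(4^k (2k+1)) = log 2`. -/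
theorem stmt_9 :
    ∃ S : ℝ,
      Tendsto (fun N : ℕ => ∑ k ∈ Finset.range N,
          zetaR (2 * (k + 1) + 1) / ((4 : ℝ) ^ (k + 1) * (2 * ((k : ℝ) + 1) + 1)))
        atTop (nhds S) ∧
      Real.eulerMascheroniConstant + S = Real.log 2 := by
  exact ⟨_, hasSum_zetaR_div.tendsto_sum_nat, add_sub_cancel _ _⟩
end

section
/- The series ∑_{k=2}^{∞} ( ζ(k) − 1 ) / k converges and ∑_{k=2}^{∞} ( ζ(k) − 1 ) / k = 1 − γ. -/
open Filter Finset

lemma hasSum_one_div_pow_div (n : ℕ) :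
    HasSum (fun k : ℕ => (1 / ((n : ℝ) + 2)) ^ (k + 2) / ((k : ℝ) + 2))
      (Real.log ((n : ℝ) + 2) - Real.log ((n : ℝ) + 1) - 1 / ((n : ℝ) + 2)) := by
  have hn : (0 : ℝ) < (n : ℝ) + 1 := by positivity
  have hn' : (0 : ℝ) < (n : ℝ) + 2 := by positivity
  have hlt : |1 / ((n : ℝ) + 2)| < 1 := by
    rw [abs_of_pos (by positivity), div_lt_one hn']
    linarith
  have h := Real.hasSum_pow_div_log_of_abs_lt_one hlt
  have hlog : -Real.log (1 - 1 / ((n : ℝ) + 2)) =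
      Real.log ((n : ℝ) + 2) - Real.log ((n : ℝ) + 1) := by
    rw [← neg_sub (Real.log _), ← Real.log_div hn.ne' hn'.ne']
    congr 2
    field_simp
    ring
  rw [hlog, ← hasSum_nat_add_iff' 1] at h
  convert! h using 1
  · funext k
    push_cast
    ring
  · simp

lemma sum_range_log_sub_one_div (N : ℕ) :
    ∑ n ∈ Finset.range N,
        (Real.log ((n : ℝ) + 2) - Real.log ((n : ℝ) + 1) - 1 / ((n : ℝ) + 2)) =
      1 - ((harmonic (N + 1) : ℝ) - Real.log ((N + 1 : ℕ) : ℝ)) := by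
  induction N with
  | zero => simp
  | succ N ih =>
    rw [Finset.sum_range_succ, ih, harmonic_succ (N + 1)]
    push_cast
    rw [show (N : ℝ) + 1 + 1 = (N : ℝ) + 2 by ring]
    ring

lemma hasSum_log_sub_one_div :
    HasSum (fun n : ℕ =>
        Real.log ((n : ℝ) + 2) - Real.log ((n : ℝ) + 1) - 1 / ((n : ℝ) + 2))
      (1 - Real.eulerMascheroniConstant) := by
  rw [hasSum_iff_tendsto_nat_of_nonneg
    fun n => (hasSum_one_div_pow_div n).nonneg fun k => by positivity]
  simp_rw [sum_range_log_sub_one_div]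
  exact (Real.tendsto_harmonic_sub_log.comp (tendsto_add_atTop_nat 1)).const_sub 1

lemma hasSum_zetaR_sub_one (k : ℕ) :
    HasSum (fun n : ℕ => (1 / ((n : ℝ) + 2)) ^ (k + 2)) (zetaR (k + 2) - 1) := by
  have hs : Summable fun n : ℕ => 1 / ((n : ℝ) + 1) ^ (k + 2) := by
    have h := (summable_nat_add_iff 1).2
      (Real.summable_one_div_nat_pow.2 (show 1 < k + 2 by omega))
    simpa using h
  have h := (hasSum_nat_add_iff' 1).2 hs.hasSum
  convert! h using 1
  · funext n
    push_cast
    rw [div_pow, one_pow, add_assoc]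
    norm_num
  · simp [zetaR]

lemma hasSum_zetaR_sub_one_div :
    HasSum (fun k : ℕ => (zetaR (k + 2) - 1) / ((k : ℝ) + 2))
      (1 - Real.eulerMascheroniConstant) := by
  set f : ℕ × ℕ → ℝ := fun p => (1 / ((p.1 : ℝ) + 2)) ^ (p.2 + 2) / ((p.2 : ℝ) + 2)
  have hf : Summable f := by
    refine (summable_prod_of_nonneg fun p => by positivity).2
      ⟨fun n => (hasSum_one_div_pow_div n).summable, ?_⟩
    simp_rw [f, (hasSum_one_div_pow_div _).tsum_eq]
    exact hasSum_log_sub_one_div.summable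
  have hsum : HasSum f (1 - Real.eulerMascheroniConstant) := by
    rw [← (hf.hasSum.prod_fiberwise hasSum_one_div_pow_div).unique hasSum_log_sub_one_div]
    exact hf.hasSum
  exact ((Equiv.prodComm ℕ ℕ).hasSum_iff.2 hsum).prod_fiberwise
    fun k => (hasSum_zetaR_sub_one k).div_const _

/-- The series `∑_{k=2}^{∞} (ζ(k) − 1)/k` converges and `∑_{k=2}^{∞} (ζ(k) − 1)/k = 1 − γ`. -/
theorem stmt_10 :
    ∃ S : ℝ,
      Tendsto (fun N : ℕ => ∑ k ∈ Finset.range N, (zetaR (k + 2) - 1) / ((k : ℝ) + 2))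
        atTop (nhds S) ∧
      S = 1 - Real.eulerMascheroniConstant :=
  ⟨_, hasSum_zetaR_sub_one_div.tendsto_sum_nat, rfl⟩
end

section
/- For every integer n ≥ 0, the series ∑_{k=1}^{∞} (−1)^{k+1} H_{k,n} / ( k(k+1) ) converges and (n+1) log(n+1) − n − log(n!) = ∑_{k=1}^{∞} (−1)^{k+1} H_{k,n} / ( k(k+1) ). -/
open Filter Finset

theorem summable_one_div_succ_mul_succ_succ :
    Summable fun k : ℕ => 1 / (((k : ℝ) + 1) * ((k : ℝ) + 2)) := by
  have h : Summable fun k : ℕ => 1 / ((k + 1 : ℕ) : ℝ) ^ 2 :=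
    (summable_nat_add_iff 1).2 (Real.summable_one_div_nat_pow.2 one_lt_two)
  refine h.of_nonneg_of_le (fun k => by positivity) fun k => ?_
  push_cast
  rw [pow_two]
  gcongr
  norm_num

theorem norm_pow_div_le {y : ℝ} (hy : y ∈ Set.Icc (-1 : ℝ) 1) (k : ℕ) :
    ‖y ^ (k + 2) / (((k : ℝ) + 1) * ((k : ℝ) + 2))‖ ≤ 1 / (((k : ℝ) + 1) * ((k : ℝ) + 2)) := by
  have hpos : (0 : ℝ) < ((k : ℝ) + 1) * ((k : ℝ) + 2) := by positivity
  rw [norm_div, Real.norm_of_nonneg hpos.le, norm_pow]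
  gcongr
  exact pow_le_one₀ (norm_nonneg y) (abs_le.2 hy)

theorem hasSum_pow_div_of_abs_lt_one {y : ℝ} (hy : |y| < 1) :
    HasSum (fun k : ℕ => y ^ (k + 2) / (((k : ℝ) + 1) * ((k : ℝ) + 2)))
      ((1 - y) * Real.log (1 - y) + y) := by
  have h := Real.hasSum_pow_div_log_of_abs_lt_one hy
  have h' := (hasSum_nat_add_iff' 1).2 h
  convert (h.mul_left y).sub h' using 1
  · rfl
  · funext k
    have h1 : (k : ℝ) + 1 ≠ 0 := by positivity
    have h2 : (k : ℝ) + 2 ≠ 0 := by positivity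
    have h3 : (k : ℝ) + 1 + 1 ≠ 0 := by positivity
    push_cast
    field_simp
    ring
  · simp
    ring

/-- The power series of `(1 - y) log (1 - y) + y`, valid up to and including the endpoints. -/
theorem hasSum_pow_div_of_mem_Icc {y : ℝ} (hy : y ∈ Set.Icc (-1 : ℝ) 1) :
    HasSum (fun k : ℕ => y ^ (k + 2) / (((k : ℝ) + 1) * ((k : ℝ) + 2)))
      ((1 - y) * Real.log (1 - y) + y) := by
  have hEq : Set.EqOn (fun y : ℝ => ∑' k : ℕ, y ^ (k + 2) / (((k : ℝ) + 1) * ((k : ℝ) + 2)))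
      (fun y => (1 - y) * Real.log (1 - y) + y) (Set.Icc (-1) 1) := by
    refine Set.EqOn.of_subset_closure (s := Set.Ioo (-1) 1)
      (fun z hz => (hasSum_pow_div_of_abs_lt_one (abs_lt.2 hz)).tsum_eq) ?_ ?_
      Set.Ioo_subset_Icc_self (closure_Ioo (by norm_num)).ge
    · exact continuousOn_tsum (fun k => by fun_prop) summable_one_div_succ_mul_succ_succ
        fun k z hz => norm_pow_div_le hz k
    · exact ((Real.continuous_mul_log.comp (continuous_const.sub continuous_id)).add
        continuous_id).continuousOn
  exact (summable_one_div_succ_mul_succ_succ.of_norm_bounded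
    (norm_pow_div_le hy)).hasSum_iff.2 (hEq hy)

theorem hasSum_neg_one_pow_mul_one_div_pow (j : ℕ) :
    HasSum (fun k : ℕ => (-1 : ℝ) ^ (k + 2) * (1 / ((j : ℝ) + 1) ^ (k + 1)) /
        (((k : ℝ) + 1) * ((k : ℝ) + 2)))
      (((j : ℝ) + 2) * (Real.log ((j : ℝ) + 2) - Real.log ((j : ℝ) + 1)) - 1) := by
  have hj : (0 : ℝ) < (j : ℝ) + 1 := by positivity
  have hle : 1 / ((j : ℝ) + 1) ≤ 1 := (div_le_one hj).2 (by linarith [j.cast_nonneg (α := ℝ)])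
  have hnn : 0 ≤ 1 / ((j : ℝ) + 1) := by positivity
  have h := (hasSum_pow_div_of_mem_Icc (y := -(1 / ((j : ℝ) + 1)))
    ⟨by linarith, by linarith⟩).mul_left ((j : ℝ) + 1)
  convert h using 1
  · rfl
  · funext k
    rw [neg_pow (1 / ((j : ℝ) + 1)), div_pow, one_pow]
    field_simp
    ring
  · have h2 : 1 - -(1 / ((j : ℝ) + 1)) = ((j : ℝ) + 2) / ((j : ℝ) + 1) := by
      field_simp
      ring
    rw [h2, Real.log_div (by positivity) hj.ne']
    field_simp
    ring

theorem sum_mul_log_sub_log (n : ℕ) :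
    ∑ j ∈ Finset.range n,
        (((j : ℝ) + 2) * (Real.log ((j : ℝ) + 2) - Real.log ((j : ℝ) + 1)) - 1) =
      ((n : ℝ) + 1) * Real.log ((n : ℝ) + 1) - (n : ℝ) - Real.log (n.factorial : ℝ) := by
  induction n with
  | zero => simp
  | succ n ih =>
    rw [Finset.sum_range_succ, ih, Nat.factorial_succ, Nat.cast_mul,
      Real.log_mul (by positivity) (by positivity)]
    push_cast
    rw [show (n : ℝ) + 1 + 1 = n + 2 by ring]
    ring

/-- For every integer `n ≥ 0`, the series `∑_{k=1}^{∞} (-1)^{k+1} H_{k,n}/(k(k+1))` converges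
and `(n+1)log(n+1) − n − log(n!) = ∑_{k=1}^{∞} (-1)^{k+1} H_{k,n}/(k(k+1))`. -/
theorem stmt_12 (n : ℕ) :
    ∃ S : ℝ,
      Tendsto (fun N : ℕ => ∑ k ∈ Finset.range N,
          (-1 : ℝ) ^ (k + 2) * Hgen (k + 1) n / (((k : ℝ) + 1) * ((k : ℝ) + 2)))
        atTop (nhds S) ∧
      ((n : ℝ) + 1) * Real.log ((n : ℝ) + 1) - (n : ℝ) - Real.log (n.factorial : ℝ) = S := by
  refine ⟨_, ?_, rfl⟩
  rw [← sum_mul_log_sub_log]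
  convert (hasSum_sum fun j (_ : j ∈ Finset.range n) =>
    hasSum_neg_one_pow_mul_one_div_pow j).tendsto_sum_nat using 4
  rw [Hgen, Finset.mul_sum, Finset.sum_div]
end

section
/- For every integer n ≥ 1, ∑_{k=1}^{n} 1/(n+k) = n/(2n+1) + ∑_{k=1}^{n} 1/(8k³ − 2k). -/
open Finset

/-- The recurrence `(H_{2n+2} - H_{n+1}) + 1/(n+1) = (H_{2n} - H_n) + 1/(2n+1) + 1/(2n+2)`. -/
theorem sum_one_div_add_succ (n : ℕ) :
    ∑ k ∈ range (n + 1), (1 : ℚ) / (((n + 1 : ℕ) : ℚ) + ((k : ℚ) + 1)) + 1 / ((n : ℚ) + 1) =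
      ∑ k ∈ range n, (1 : ℚ) / ((n : ℚ) + ((k : ℚ) + 1)) +
        1 / (2 * (n : ℚ) + 1) + 1 / (2 * (n : ℚ) + 2) := by
  have h := sum_range_succ' (fun k : ℕ => (1 : ℚ) / ((n : ℚ) + ((k : ℚ) + 1))) (n + 1)
  rw [sum_range_succ, sum_range_succ] at h
  convert h.symm using 2
  · refine sum_congr rfl fun k _ => ?_
    push_cast
    ring
  · simp
  · ring
  · push_cast
    ring

/-- Ramanujan's identity: for every `n ≥ 1`,
`∑_{k=1}^{n} 1/(n+k) = n/(2n+1) + ∑_{k=1}^{n} 1/(8k³ − 2k)`. -/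
theorem stmt_13 (n : ℕ) (hn : 1 ≤ n) :
    ∑ k ∈ Finset.range n, (1 : ℚ) / ((n : ℚ) + ((k : ℚ) + 1)) =
      (n : ℚ) / (2 * (n : ℚ) + 1) +
        ∑ k ∈ Finset.range n, (1 : ℚ) / (8 * ((k : ℚ) + 1) ^ 3 - 2 * ((k : ℚ) + 1)) := by
  clear hn
  induction n with
  | zero => simp
  | succ n ih =>
    rw [eq_sub_of_add_eq (sum_one_div_add_succ n), ih, sum_range_succ _ n]
    have hcubic : 8 * ((n : ℚ) + 1) ^ 3 - 2 * ((n : ℚ) + 1) =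
        2 * (n + 1) * (2 * n + 1) * (2 * n + 3) := by ring
    have hodd : 2 * ((n + 1 : ℕ) : ℚ) + 1 = 2 * n + 3 := by push_cast; ring
    have heven : 2 * (n : ℚ) + 2 = 2 * (n + 1) := by ring
    rw [hcubic, hodd, heven]
    push_cast
    field_simp
    ring
end

section
/- The series ∑_{k=1}^{∞} ( 24k² − 2 ) / ( 8k³ − 2k )² converges and ζ(2) = π²/6 = 1 + ∑_{k=1}^{∞} ( 24k² − 2 ) / ( 8k³ − 2k )². -/
open Filter Finset

theorem hasSum_one_div_succ_sq :
    HasSum (fun n : ℕ => (1 : ℝ) / ((n : ℝ) + 1) ^ 2) (Real.pi ^ 2 / 6) := by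
  have h := (hasSum_nat_add_iff' (f := fun n : ℕ => (1 : ℝ) / (n : ℝ) ^ 2) 1).2 hasSum_zeta_two
  simpa using h

theorem sum_range_ramanujan_term (N : ℕ) :
    ∑ k ∈ Finset.range N,
        (24 * ((k : ℝ) + 1) ^ 2 - 2) / (8 * ((k : ℝ) + 1) ^ 3 - 2 * ((k : ℝ) + 1)) ^ 2 =
      2 * ∑ n ∈ Finset.range (2 * N), 1 / ((n : ℝ) + 1) ^ 2 -
        ∑ n ∈ Finset.range N, 1 / ((n : ℝ) + 1) ^ 2 - 1 + 1 / (2 * (N : ℝ) + 1) ^ 2 := by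
  induction N with
  | zero => simp
  | succ N ih =>
    rw [Finset.sum_range_succ, ih, Nat.mul_succ 2 N, Finset.sum_range_succ _ (2 * N + 1),
      Finset.sum_range_succ _ (2 * N), Finset.sum_range_succ _ N]
    push_cast
    have h : 8 * ((N : ℝ) + 1) ^ 3 - 2 * ((N : ℝ) + 1) =
        2 * ((N : ℝ) + 1) * (2 * N + 1) * (2 * N + 3) := by ring
    have h₂ : 2 * (N : ℝ) + 1 + 1 = 2 * (N + 1) := by ring
    have h₃ : 2 * ((N : ℝ) + 1) + 1 = 2 * N + 3 := by ring
    rw [h, h₂, h₃]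
    field_simp
    ring

/-- The series `∑_{k=1}^{∞} (24k² − 2)/(8k³ − 2k)²` converges and
`ζ(2) = π²/6 = 1 + ∑_{k=1}^{∞} (24k² − 2)/(8k³ − 2k)²`. -/
theorem stmt_14 :
    ∃ S : ℝ,
      Tendsto (fun N : ℕ => ∑ k ∈ Finset.range N,
          (24 * ((k : ℝ) + 1) ^ 2 - 2) / (8 * ((k : ℝ) + 1) ^ 3 - 2 * ((k : ℝ) + 1)) ^ 2)
        atTop (nhds S) ∧
      zetaR 2 = Real.pi ^ 2 / 6 ∧ Real.pi ^ 2 / 6 = 1 + S := by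
  refine ⟨Real.pi ^ 2 / 6 - 1, ?_, hasSum_one_div_succ_sq.tsum_eq, by ring⟩
  simp_rw [sum_range_ramanujan_term]
  have hH := hasSum_one_div_succ_sq.tendsto_sum_nat
  have hdouble : Tendsto (fun N : ℕ => 2 * N) atTop atTop :=
    tendsto_id.const_mul_atTop' two_pos
  have hodd : Tendsto (fun N : ℕ => 1 / (2 * (N : ℝ) + 1) ^ 2) atTop (nhds 0) := by
    have h := hasSum_one_div_succ_sq.summable.tendsto_atTop_zero.comp hdouble
    simpa [Function.comp_def] using h
  convert! ((((hH.comp hdouble).const_mul 2).sub hH).sub_const 1).add hodd using 2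
  ring
end

section
/- lim_{n→∞} ∑_{k=0}^{n} (k/n)^n = e/(e−1), i.e. the sequence n ↦ ∑_{k=0}^{n} (k/n)^n (for n ≥ 1) converges to e/(e−1), where e is the base of the natural logarithm. -/
open Filter Finset

/-- `lim_{n→∞} ∑_{k=0}^{n} (k/n)^n = e/(e−1)`. -/
theorem stmt_15 :
    Tendsto (fun n : ℕ => ∑ k ∈ Finset.range (n + 1), ((k : ℝ) / (n : ℝ)) ^ n)
      atTop (nhds (Real.exp 1 / (Real.exp 1 - 1))) := by
  have hlt : Real.exp (-1) < 1 := by simp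
  have hpow (j : ℕ) : Real.exp (-1) ^ j = Real.exp (-(j : ℝ)) := by
    rw [← Real.exp_nat_mul]; simp
  have hlim : ∑' j : ℕ, Real.exp (-1) ^ j = Real.exp 1 / (Real.exp 1 - 1) := by
    have : Real.exp 1 - 1 ≠ 0 := by linarith [Real.add_one_lt_exp (one_ne_zero (α := ℝ))]
    rw [tsum_geometric_of_lt_one (Real.exp_pos _).le hlt, Real.exp_neg]
    field_simp
  have hsum (n : ℕ) : ∑ k ∈ Finset.range (n + 1), ((k : ℝ) / (n : ℝ)) ^ n =
      ∑' j : ℕ, if j ∈ Finset.range (n + 1) then (((n : ℝ) - j) / n) ^ n else 0 := by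
    rw [← Finset.sum_range_reflect, tsum_eq_sum (s := Finset.range (n + 1)) fun j hj => if_neg hj]
    refine Finset.sum_congr rfl fun j hj => ?_
    rw [if_pos hj, Nat.add_sub_cancel,
      Nat.cast_sub (Nat.lt_succ_iff.1 (Finset.mem_range.1 hj))]
  simp only [hsum]
  rw [← hlim]
  refine tendsto_tsum_of_dominated_convergence
    (summable_geometric_of_lt_one (Real.exp_pos _).le hlt) (fun j => ?_)
    (Eventually.of_forall fun n j => ?_)
  · rw [hpow]
    refine (Real.tendsto_one_add_div_pow_exp (-(j : ℝ))).congr' ?_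
    filter_upwards [eventually_ge_atTop j, eventually_gt_atTop 0] with n hj hn
    have hn' : (n : ℝ) ≠ 0 := by exact_mod_cast hn.ne'
    rw [if_pos (Finset.mem_range.2 (by omega)), sub_div, div_self hn', neg_div, sub_eq_add_neg]
  · split_ifs with h
    · have hj : (j : ℝ) ≤ n := by exact_mod_cast Nat.lt_succ_iff.1 (Finset.mem_range.1 h)
      have h0 : 0 ≤ ((n : ℝ) - j) / n := div_nonneg (sub_nonneg.2 hj) n.cast_nonneg
      rw [Real.norm_of_nonneg (pow_nonneg h0 n), hpow]
      rcases n.eq_zero_or_pos with rfl | hn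
      · simp at h; simp [h]
      · have hn' : (n : ℝ) ≠ 0 := by exact_mod_cast hn.ne'
        rw [sub_div, div_self hn']
        exact Real.one_sub_div_pow_le_exp_neg hj
    · rw [norm_zero]; positivity
end

section
/- The series ∑_{k=1}^{∞} (−1)^{k+1} ( H_k − log k − γ ) converges and ∑_{k=1}^{∞} (−1)^{k+1} ( H_k − log k − γ ) = ( log π − γ ) / 2. -/
open Filter Finset

theorem H_eq_harmonic (m : ℕ) : H m = (harmonic m : ℝ) := by
  simp [H, harmonic]

theorem H_succ (m : ℕ) : H (m + 1) = H m + 1 / ((m : ℝ) + 1) := by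
  simp [H, Finset.sum_range_succ]

theorem tendsto_H_sub_log :
    Tendsto (fun n : ℕ => H n - Real.log n) atTop (nhds Real.eulerMascheroniConstant) := by
  simpa only [H_eq_harmonic] using Real.tendsto_harmonic_sub_log

theorem alternating_sum_two_mul (n : ℕ) :
    ∑ k ∈ Finset.range (2 * n),
        (-1 : ℝ) ^ k * (H (k + 1) - Real.log ((k : ℝ) + 1) - Real.eulerMascheroniConstant) =
      (Real.log (Real.Wallis.W n) + Real.log (2 * n + 1) - H n) / 2 := by
  induction n with
  | zero => simp [H, Real.Wallis.W]
  | succ n ih =>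
    rw [show 2 * (n + 1) = 2 * n + 1 + 1 by ring, Finset.sum_range_succ, Finset.sum_range_succ, ih,
      H_succ (2 * n + 1), H_succ n, Real.Wallis.W_succ]
    have hW := Real.Wallis.W_pos n
    have h1 : (0 : ℝ) < 2 * n + 1 := by positivity
    have h2 : (0 : ℝ) < 2 * n + 2 := by positivity
    have h3 : (0 : ℝ) < 2 * n + 3 := by positivity
    rw [Real.log_mul hW.ne' (by positivity), Real.log_mul (by positivity) (by positivity),
      Real.log_div h2.ne' h1.ne', Real.log_div h2.ne' h3.ne', pow_succ, pow_mul]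
    push_cast
    rw [show (2 * (n : ℝ) + 1 + 1) = 2 * n + 2 by ring,
      show (2 * ((n : ℝ) + 1) + 1) = 2 * n + 3 by ring,
      show 1 / ((n : ℝ) + 1) = 2 * (1 / (2 * n + 2)) by field_simp]
    norm_num
    ring

theorem tendsto_log_W_add_log_sub_H :
    Tendsto (fun n : ℕ => (Real.log (Real.Wallis.W n) + Real.log (2 * n + 1) - H n) / 2)
      atTop (nhds ((Real.log Real.pi - Real.eulerMascheroniConstant) / 2)) := by
  have hW : Tendsto (fun n : ℕ => Real.log (Real.Wallis.W n)) atTop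
      (nhds (Real.log (Real.pi / 2))) :=
    Real.Wallis.tendsto_W_nhds_pi_div_two.log (by positivity)
  have hq : Tendsto (fun n : ℕ => Real.log (2 + 1 / (n : ℝ))) atTop (nhds (Real.log 2)) := by
    have h := tendsto_one_div_atTop_nhds_zero_nat (𝕜 := ℝ).const_add 2
    rw [add_zero] at h
    exact h.log two_ne_zero
  have h := ((hW.add hq).sub tendsto_H_sub_log).div_const 2
  rw [Real.log_div Real.pi_ne_zero two_ne_zero, sub_add_cancel] at h
  refine h.congr' ?_
  filter_upwards [eventually_gt_atTop 0] with n hn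
  have hn' : (0 : ℝ) < n := by exact_mod_cast hn
  rw [show 2 + 1 / (n : ℝ) = (2 * n + 1) / n by field_simp,
    Real.log_div (by positivity) hn'.ne']
  ring

/-- The series `∑_{k=1}^{∞} (-1)^{k+1} (H_k − log k − γ)` converges and equals
`(log π − γ)/2`. -/
theorem stmt_16 :
    Tendsto (fun N : ℕ => ∑ k ∈ Finset.range N,
        (-1 : ℝ) ^ k * (H (k + 1) - Real.log ((k : ℝ) + 1) - Real.eulerMascheroniConstant))
      atTop (nhds ((Real.log Real.pi - Real.eulerMascheroniConstant) / 2)) := by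
  have hterm : Tendsto (fun k : ℕ =>
      H (k + 1) - Real.log ((k : ℝ) + 1) - Real.eulerMascheroniConstant) atTop (nhds 0) := by
    have h := (tendsto_H_sub_log.comp (tendsto_add_atTop_nat 1)).sub_const
      Real.eulerMascheroniConstant
    rw [sub_self] at h
    simpa [Function.comp_def] using h
  have heven := tendsto_log_W_add_log_sub_H
  simp only [← alternating_sum_two_mul] at heven
  have hodd := heven.add (hterm.comp (tendsto_id.const_mul_atTop' (r := 2) two_pos))
  rw [add_zero] at hodd
  rw [Filter.tendsto_def] at heven hodd ⊢
  intro s hs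
  obtain ⟨a, ha⟩ := mem_atTop_sets.1 (heven s hs)
  obtain ⟨b, hb⟩ := mem_atTop_sets.1 (hodd s hs)
  refine mem_atTop_sets.2 ⟨2 * (a + b), fun N hN => ?_⟩
  obtain ⟨m, rfl | rfl⟩ := Nat.even_or_odd' N
  · exact ha m (by omega)
  · have h := hb m (by omega)
    simpa [Finset.sum_range_succ, pow_mul] using h
end

section
/- For every integer s ≥ 1, B_s = ( s / (1 − 2^s) ) · ∑_{k=0}^{s−1} 2^{−(k+1)} ∑_{j=0}^{k} (−1)^j C(k,j) j^{s−1}, where B_s is the s-th Bernoulli number with the convention B₁ = −1/2, C(k,j) is the binomial coefficient, and 0⁰ = 1. -/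
open Finset

open PowerSeries in
/-- The generating function identity `x/(e^x - 1) - 2x/(e^{2x} - 1) = x/(e^x + 1)`,
with the denominator cleared. -/
theorem bernoulliPowerSeries_sub_rescale_mul_exp_add_one :
    (bernoulliPowerSeries ℚ - rescale 2 (bernoulliPowerSeries ℚ)) * (exp ℚ + 1) = X := by
  have h1 := bernoulliPowerSeries_mul_exp_sub_one ℚ
  have h2 := congrArg (rescale (2 : ℚ)) h1
  have h3 : rescale (2 : ℚ) (exp ℚ) = exp ℚ ^ 2 := by
    simpa using (exp_pow_eq_rescale_exp (A := ℚ) 2).symm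
  rw [map_mul, map_sub, map_one, h3, rescale_X, map_ofNat] at h2
  have hne : exp ℚ - 1 ≠ 0 := by
    intro h
    rw [h, mul_zero] at h1
    exact X_ne_zero h1.symm
  apply mul_right_cancel₀ hne
  linear_combination (exp ℚ + 1) * h1 - h2

open PowerSeries in
theorem coeff_one_sub_exp_pow (k n : ℕ) :
    coeff n ((1 - exp ℚ) ^ k) =
      (∑ j ∈ range (k + 1), (-1 : ℚ) ^ j * (k.choose j : ℚ) * (j : ℚ) ^ n) / (n.factorial : ℚ) := by
  rw [show (1 - exp ℚ : ℚ⟦X⟧) = -exp ℚ + 1 by ring, add_pow, map_sum, sum_div]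
  refine sum_congr rfl fun j _ ↦ ?_
  have h : (-exp ℚ) ^ j * 1 ^ (k - j) * (k.choose j : ℚ⟦X⟧) =
      C ((-1 : ℚ) ^ j * (k.choose j : ℚ)) * rescale (j : ℚ) (exp ℚ) := by
    rw [← exp_pow_eq_rescale_exp, neg_pow]
    simp only [map_mul, map_pow, map_neg, map_one, map_natCast]
    ring
  rw [h, coeff_C_mul, coeff_rescale, coeff_exp]
  simp
  ring

open PowerSeries in
/-- Closed-form double-sum expression for the Bernoulli numbers (convention `B₁ = −1/2`):
for `s ≥ 1`, `B_s = (s/(1 − 2^s)) ∑_{k=0}^{s−1} 2^{−(k+1)} ∑_{j=0}^{k} (−1)^j C(k,j) j^{s−1}`,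
with `0⁰ = 1`. -/
theorem stmt_18 (s : ℕ) (hs : 1 ≤ s) :
    bernoulli s = ((s : ℚ) / (1 - 2 ^ s)) *
      ∑ k ∈ Finset.range s, (1 / 2 ^ (k + 1)) *
        ∑ j ∈ Finset.range (k + 1), (-1 : ℚ) ^ j * (k.choose j : ℚ) * (j : ℚ) ^ (s - 1) := by
  obtain ⟨n, rfl⟩ : ∃ n, s = n + 1 := ⟨s - 1, by omega⟩
  rw [Nat.add_sub_cancel]
  set D := bernoulliPowerSeries ℚ - rescale 2 (bernoulliPowerSeries ℚ) with hD
  set v : ℚ⟦X⟧ := C (1 / 2) * (1 - exp ℚ) with hv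
  have hDX : D * (exp ℚ + 1) = X := bernoulliPowerSeries_sub_rescale_mul_exp_add_one
  have hC : (C (1 / 2) : ℚ⟦X⟧) * 2 = 1 := by
    rw [← map_ofNat C, ← map_mul]
    norm_num
  have hgeom := geom_sum_mul v (n + 1)
  have key : D - D * v ^ (n + 1) =
      X * (C (1 / 2) * ∑ k ∈ range (n + 1), v ^ k) := by
    linear_combination D * hgeom +
      (C (1 / 2) * ∑ k ∈ range (n + 1), v ^ k) * hDX -
      D * (∑ k ∈ range (n + 1), v ^ k) * (hv + hC)
  have hXv : X ∣ v := by
    rw [X_dvd_iff]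
    simp [hv]
  have hXD : X ∣ D := by
    rw [X_dvd_iff, ← coeff_zero_eq_constantCoeff_apply]
    rw [hD, map_sub, coeff_rescale, pow_zero, one_mul, sub_self]
  have hvanish : coeff (n + 1) (D * v ^ (n + 1)) = 0 := by
    have h : X ^ (n + 2) ∣ D * v ^ (n + 1) := by
      rw [pow_succ' X (n + 1)]
      exact mul_dvd_mul hXD (pow_dvd_pow_of_dvd hXv _)
    exact X_pow_dvd_iff.mp h _ (by omega)
  have hcoeff := congrArg (coeff (n + 1)) key
  rw [map_sub, hvanish, sub_zero, coeff_succ_X_mul, coeff_C_mul, map_sum] at hcoeff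
  have hterm (k : ℕ) : coeff n (v ^ k) = (1 / 2) ^ k *
      ((∑ j ∈ range (k + 1), (-1 : ℚ) ^ j * (k.choose j : ℚ) * (j : ℚ) ^ n) /
        (n.factorial : ℚ)) := by
    rw [hv, mul_pow, ← map_pow, coeff_C_mul, coeff_one_sub_exp_pow]
  have hDcoeff : coeff (n + 1) D =
      (1 - 2 ^ (n + 1)) * (bernoulli (n + 1) / ((n + 1).factorial : ℚ)) := by
    simp [hD, bernoulliPowerSeries, coeff_rescale]
    ring
  have hsum : ∑ k ∈ range (n + 1), (1 / 2 ^ (k + 1) : ℚ) *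
        ∑ j ∈ range (k + 1), (-1 : ℚ) ^ j * (k.choose j : ℚ) * (j : ℚ) ^ n =
      (n.factorial : ℚ) * coeff (n + 1) D := by
    rw [hcoeff, mul_sum, mul_sum]
    refine sum_congr rfl fun k _ ↦ ?_
    rw [hterm, one_div_pow]
    field_simp
    ring
  have hpow : (1 - 2 ^ (n + 1) : ℚ) ≠ 0 :=
    sub_ne_zero.mpr (one_lt_pow₀ one_lt_two n.succ_ne_zero).ne
  rw [hsum, hDcoeff, Nat.factorial_succ]
  push_cast
  field_simp
end

section
/- For every complex number s ≠ 1, the double series ∑_{k=0}^{∞} 2^{−(k+1)} ∑_{j=0}^{k} (−1)^j C(k,j) (j+1)^{−s} converges and ( 1 − 2^{1−s} ) ζ(s) = ∑_{k=0}^{∞} 2^{−(k+1)} ∑_{j=0}^{k} (−1)^j C(k,j) (j+1)^{−s}, where ζ denotes the Riemann zeta function (meromorphically continued to ℂ with its only pole at s = 1) and C(k,j) is the binomial coefficient. -/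
open Filter Finset

/-- The `k`-th alternating binomial difference of `j ↦ (j + 1) ^ (-s)`. -/
noncomputable def hasseDiff (k : ℕ) (s : ℂ) : ℂ :=
  ∑ j ∈ Finset.range (k + 1), (-1 : ℂ) ^ j * (k.choose j : ℂ) * ((j : ℂ) + 1) ^ (-s)

lemma hasSum_choose_div_two_pow (j : ℕ) :
    HasSum (fun n : ℕ => ((n + j).choose j : ℝ) * (1 / 2) ^ (n + j + 1)) 1 := by
  have h := (hasSum_choose_mul_geometric_of_norm_lt_one j (r := (1 / 2 : ℝ))
    (by norm_num)).mul_right ((1 / 2 : ℝ) ^ (j + 1))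
  have e : (1 / (1 - 1 / 2 : ℝ) ^ (j + 1)) * (1 / 2 : ℝ) ^ (j + 1) = 1 := by
    norm_num [← mul_pow]
  rw [e] at h
  refine h.congr_fun ?_
  intro n
  ring

/-- Euler's transformation of an alternating series with absolutely summable terms. -/
lemma hasSum_euler_transform {a : ℕ → ℂ} (ha : Summable fun j => ‖a j‖) :
    HasSum (fun k : ℕ => (1 / 2 ^ (k + 1) : ℂ) *
      ∑ j ∈ Finset.range (k + 1), (-1 : ℂ) ^ j * (k.choose j : ℂ) * a j)
      (∑' j, (-1 : ℂ) ^ j * a j) := by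
  let f : ℕ × ℕ → ℂ := fun p =>
    (((p.2 + p.1).choose p.1 : ℝ) * (1 / 2) ^ (p.2 + p.1 + 1) : ℝ) * ((-1 : ℂ) ^ p.1 * a p.1)
  have hrow (j : ℕ) : HasSum (fun n => f (j, n)) ((-1 : ℂ) ^ j * a j) := by
    simpa [f] using
      (Complex.hasSum_ofReal.2 (hasSum_choose_div_two_pow j)).mul_right ((-1 : ℂ) ^ j * a j)
  have hnorm (j : ℕ) : HasSum (fun n => ‖f (j, n)‖) ‖a j‖ := by
    have h := (hasSum_choose_div_two_pow j).mul_right ‖a j‖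
    rw [one_mul] at h
    refine h.congr_fun ?_
    intro n
    simp only [f, norm_mul, norm_pow, norm_neg, norm_one, one_pow, one_mul, Complex.norm_real]
    rw [Real.norm_of_nonneg (by positivity), Real.norm_of_nonneg (by positivity)]
  have hf : Summable f := by
    refine Summable.of_norm ((summable_prod_of_nonneg fun p => norm_nonneg _).2
      ⟨fun j => (hnorm j).summable, ?_⟩)
    simpa only [(hnorm _).tsum_eq] using ha
  have hsum : HasSum f (∑' j, (-1 : ℂ) ^ j * a j) := by
    have h := hf.hasSum.prod_fiberwise hrow
    rw [h.tsum_eq]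
    exact hf.hasSum
  have hk := (Finset.HasAntidiagonal.sigmaAntidiagonalEquivProd (A := ℕ)).hasSum_iff.2 hsum
  refine (hk.sigma fun k => hasSum_fintype _).congr_fun ?_
  intro k
  rw [Finset.univ_eq_attach, Finset.mul_sum]
  refine Eq.trans ?_ ((Finset.HasAntidiagonal.antidiagonal k).sum_attach f).symm
  rw [Finset.Nat.sum_antidiagonal_eq_sum_range_succ_mk]
  refine Finset.sum_congr rfl fun j hj => ?_
  have hj : k - j + j = k := Nat.sub_add_cancel (Nat.lt_succ_iff.1 (Finset.mem_range.1 hj))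
  simp only [f, hj]
  push_cast
  rw [one_div_pow]
  ring

lemma summable_norm_nat_add_one_cpow {s : ℂ} (hs : 1 < s.re) :
    Summable fun j : ℕ => ‖((j : ℂ) + 1) ^ (-s)‖ := by
  have h := ((summable_nat_add_iff 1).2 (Complex.summable_one_div_nat_cpow.2 hs)).norm
  simpa [Complex.cpow_neg] using h

lemma tsum_alternating_nat_add_one_cpow {s : ℂ} (hs : 1 < s.re) :
    ∑' j : ℕ, (-1 : ℂ) ^ j * ((j : ℂ) + 1) ^ (-s) = (1 - (2 : ℂ) ^ (1 - s)) * riemannZeta s := by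
  have hsum : Summable fun j : ℕ => ((j : ℂ) + 1) ^ (-s) :=
    (summable_norm_nat_add_one_cpow hs).of_norm
  have hzeta : HasSum (fun j : ℕ => ((j : ℂ) + 1) ^ (-s)) (riemannZeta s) := by
    rw [zeta_eq_tsum_one_div_nat_add_one_cpow hs]
    simpa [Complex.cpow_neg] using hsum.hasSum
  have hodd : HasSum (fun i : ℕ => (((2 * i + 1 : ℕ) : ℂ) + 1) ^ (-s))
      ((2 : ℂ) ^ (-s) * riemannZeta s) := by
    refine (hzeta.mul_left ((2 : ℂ) ^ (-s))).congr_fun ?_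
    intro i
    have e : (((2 * i + 1 : ℕ) : ℂ) + 1) = ((2 : ℕ) : ℂ) * ((i + 1 : ℕ) : ℂ) := by
      push_cast; ring
    rw [e, Complex.natCast_mul_natCast_cpow, Nat.cast_ofNat, Nat.cast_add_one]
  have heven : Summable fun i : ℕ => (((2 * i : ℕ) : ℂ) + 1) ^ (-s) :=
    hsum.comp_injective (i := fun i => 2 * i) fun a b h => by simpa using h
  have hE : (∑' i : ℕ, (((2 * i : ℕ) : ℂ) + 1) ^ (-s)) + (2 : ℂ) ^ (-s) * riemannZeta s =
      riemannZeta s :=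
    (HasSum.even_add_odd (f := fun j : ℕ => ((j : ℂ) + 1) ^ (-s)) heven.hasSum hodd).unique hzeta
  have heta : HasSum (fun j : ℕ => (-1 : ℂ) ^ j * ((j : ℂ) + 1) ^ (-s))
      ((∑' i : ℕ, (((2 * i : ℕ) : ℂ) + 1) ^ (-s)) + -((2 : ℂ) ^ (-s) * riemannZeta s)) := by
    refine HasSum.even_add_odd ?_ ?_
    · simpa [pow_mul] using heven.hasSum
    · simpa [pow_succ, pow_mul] using hodd.neg
  have h2 : (2 : ℂ) ^ (1 - s) = 2 * (2 : ℂ) ^ (-s) := by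
    rw [sub_eq_add_neg, Complex.cpow_add _ _ two_ne_zero, Complex.cpow_one]
  rw [heta.tsum_eq, h2]
  linear_combination hE

lemma hasseDiff_eq_integral (k : ℕ) {s : ℂ} (hs : 0 < s.re) :
    hasseDiff k s * Complex.Gamma s = ∫ t : ℝ in Set.Ioi 0,
      (t : ℂ) ^ (s - 1) * Complex.exp (-t) * (1 - Complex.exp (-t)) ^ k := by
  have hΓ : Complex.Gamma s ≠ 0 := Complex.Gamma_ne_zero_of_re_pos hs
  have hval (j : ℕ) : ∫ t : ℝ in Set.Ioi 0, (t : ℂ) ^ (s - 1) *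
      Complex.exp (-(((j + 1 : ℝ) : ℂ) * t)) = ((j : ℂ) + 1) ^ (-s) * Complex.Gamma s := by
    rw [Complex.integral_cpow_mul_exp_neg_mul_Ioi hs (by positivity : (0 : ℝ) < j + 1), one_div]
    have harg : (((j : ℝ) + 1 : ℝ) : ℂ).arg ≠ Real.pi := by
      rw [Complex.arg_ofReal_of_nonneg (by positivity)]
      exact Real.pi_ne_zero.symm
    rw [Complex.inv_cpow _ _ harg, Complex.cpow_neg]
    push_cast; rfl
  have hintegrable (j : ℕ) : MeasureTheory.IntegrableOn (fun t : ℝ => (t : ℂ) ^ (s - 1) *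
      Complex.exp (-(((j + 1 : ℝ) : ℂ) * t))) (Set.Ioi 0) := by
    refine MeasureTheory.Integrable.of_integral_ne_zero ?_
    rw [hval]
    refine mul_ne_zero ?_ hΓ
    rw [Complex.cpow_ne_zero_iff]
    exact Or.inl (Nat.cast_add_one_ne_zero j)
  have hexpand (t : ℝ) : (t : ℂ) ^ (s - 1) * Complex.exp (-t) * (1 - Complex.exp (-t)) ^ k =
      ∑ j ∈ Finset.range (k + 1), (-1 : ℂ) ^ j * (k.choose j : ℂ) *
        ((t : ℂ) ^ (s - 1) * Complex.exp (-(((j + 1 : ℝ) : ℂ) * t))) := by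
    rw [sub_eq_neg_add (1 : ℂ), add_pow, Finset.mul_sum]
    refine Finset.sum_congr rfl fun j _ => ?_
    have e : Complex.exp (-(((j + 1 : ℝ) : ℂ) * t)) =
        Complex.exp (-t) ^ j * Complex.exp (-t) := by
      rw [← Complex.exp_nat_mul, ← Complex.exp_add]
      push_cast; ring_nf
    rw [e, neg_pow, one_pow]
    ring
  simp_rw [hexpand]
  rw [MeasureTheory.integral_finsetSum _ fun j _ => (hintegrable j).const_mul _]
  simp_rw [MeasureTheory.integral_const_mul, hval]
  rw [hasseDiff, Finset.sum_mul]
  exact Finset.sum_congr rfl fun j _ => by ring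

lemma norm_hasseDiff_le (k : ℕ) {s : ℂ} (hs : 0 < s.re) :
    ‖hasseDiff k s‖ ≤ Real.Gamma s.re * ‖(Complex.Gamma s)⁻¹‖ := by
  have hΓ : Complex.Gamma s ≠ 0 := Complex.Gamma_ne_zero_of_re_pos hs
  rw [norm_inv, ← div_eq_mul_inv, le_div_iff₀ (norm_pos_iff.2 hΓ), ← norm_mul,
    hasseDiff_eq_integral k hs, Real.Gamma_eq_integral hs]
  refine MeasureTheory.norm_integral_le_of_norm_le (Real.GammaIntegral_convergent hs) ?_
  filter_upwards [MeasureTheory.ae_restrict_mem measurableSet_Ioi] with t ht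
  have ht : 0 < t := ht
  have he : 1 - Complex.exp (-t) = ((1 - Real.exp (-t) : ℝ) : ℂ) := by push_cast; rfl
  have he1 : Real.exp (-t) ≤ 1 := Real.exp_le_one_iff.2 (by linarith)
  rw [norm_mul, norm_mul, Complex.norm_cpow_eq_rpow_re_of_pos ht, he, norm_pow, Complex.norm_real,
    Real.norm_of_nonneg (by linarith), Complex.norm_exp, mul_comm (t ^ _)]
  simp only [Complex.sub_re, Complex.one_re, Complex.neg_re, Complex.ofReal_re]
  exact mul_le_of_le_one_right (by positivity)
    (pow_le_one₀ (by linarith) (by linarith [Real.exp_pos (-t)]))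

lemma hasseDiff_sub_one (k : ℕ) (s : ℂ) :
    hasseDiff k (s - 1) = (k + 1) * hasseDiff k s - k * hasseDiff (k - 1) s := by
  have hpow (j : ℕ) : ((j : ℂ) + 1) ^ (-(s - 1)) = ((j : ℂ) + 1) * ((j : ℂ) + 1) ^ (-s) := by
    rw [neg_sub, sub_eq_add_neg, Complex.cpow_add _ _ (Nat.cast_add_one_ne_zero j),
      Complex.cpow_one]
  cases k with
  | zero => simp [hasseDiff]
  | succ k =>
    have hext : hasseDiff k s = ∑ j ∈ Finset.range (k + 1 + 1),
        (-1 : ℂ) ^ j * (k.choose j : ℂ) * ((j : ℂ) + 1) ^ (-s) := by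
      rw [Finset.sum_range_succ, hasseDiff]
      simp
    rw [Nat.add_sub_cancel, hext, hasseDiff, hasseDiff, Finset.mul_sum, Finset.mul_sum,
      ← Finset.sum_sub_distrib]
    refine Finset.sum_congr rfl fun j hj => ?_
    have hj' : j ≤ k + 1 := Nat.lt_succ_iff.1 (Finset.mem_range.1 hj)
    have hc := congrArg (Nat.cast : ℕ → ℂ) (Nat.choose_mul_succ_eq k j)
    push_cast [Nat.cast_sub hj'] at hc
    rw [hpow]
    push_cast
    linear_combination (-1 : ℂ) ^ j * ((j : ℂ) + 1) ^ (-s) * hc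

lemma norm_hasseDiff_sub_nat_le (m k : ℕ) {s : ℂ} (hs : 0 < s.re) :
    ‖hasseDiff k (s - m)‖ ≤
      (2 * (k + 1 : ℝ)) ^ m * (Real.Gamma s.re * ‖(Complex.Gamma s)⁻¹‖) := by
  induction m generalizing k with
  | zero => simpa using norm_hasseDiff_le k hs
  | succ m ih =>
    set G := Real.Gamma s.re * ‖(Complex.Gamma s)⁻¹‖
    have hG : 0 ≤ G := mul_nonneg (Real.Gamma_pos_of_pos hs).le (norm_nonneg _)
    have hpred : ‖hasseDiff (k - 1) (s - m)‖ ≤ (2 * (k + 1 : ℝ)) ^ m * G := by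
      refine (ih (k - 1)).trans ?_
      have : ((k - 1 : ℕ) : ℝ) ≤ k := Nat.cast_le.2 (Nat.sub_le k 1)
      gcongr
    have e : s - ((m + 1 : ℕ) : ℂ) = s - m - 1 := by push_cast; ring
    rw [e, hasseDiff_sub_one]
    calc ‖(k + 1) * hasseDiff k (s - m) - k * hasseDiff (k - 1) (s - m)‖
        ≤ ‖((k : ℂ) + 1) * hasseDiff k (s - m)‖ + ‖(k : ℂ) * hasseDiff (k - 1) (s - m)‖ :=
          norm_sub_le _ _
      _ = (k + 1) * ‖hasseDiff k (s - m)‖ + k * ‖hasseDiff (k - 1) (s - m)‖ := by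
          rw [norm_mul, norm_mul, Complex.norm_natCast, ← Nat.cast_succ, Complex.norm_natCast,
            Nat.cast_succ]
      _ ≤ (k + 1) * ((2 * (k + 1 : ℝ)) ^ m * G) + (k + 1) * ((2 * (k + 1 : ℝ)) ^ m * G) := by
          gcongr
          · exact ih k
          · linarith
      _ = (2 * (k + 1 : ℝ)) ^ (m + 1) * G := by ring

lemma differentiable_hasseDiff (k : ℕ) : Differentiable ℂ (hasseDiff k) := by
  unfold hasseDiff
  refine Differentiable.fun_sum fun j _ => ?_
  refine Differentiable.const_mul ?_ _
  exact differentiable_neg.const_cpow (Or.inl (Nat.cast_add_one_ne_zero j))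

/-- Near every point, the terms of Hasse's series are dominated by a summable sequence. -/
lemma exists_summable_bound_hasseDiff (s₀ : ℂ) :
    ∃ U : Set ℂ, IsOpen U ∧ s₀ ∈ U ∧ ∃ u : ℕ → ℝ, Summable u ∧
      ∀ k, ∀ s ∈ U, ‖(1 / 2 ^ (k + 1) : ℂ) * hasseDiff k s‖ ≤ u k := by
  obtain ⟨m, hm⟩ := exists_nat_gt (-s₀.re)
  let g : ℂ → ℝ := fun s => Real.Gamma (s + m).re * ‖(Complex.Gamma (s + m))⁻¹‖
  have hre : 0 < (s₀ + m).re := by simp; linarith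
  have hg : ContinuousAt g s₀ := by
    refine ContinuousAt.mul ?_ ?_
    · have h1 : ContinuousAt Real.Gamma (s₀ + m).re :=
        (Real.differentiableAt_Gamma fun n => by
          have : (0 : ℝ) ≤ n := n.cast_nonneg
          linarith).continuousAt
      exact ContinuousAt.comp (f := fun s : ℂ => (s + m).re) h1 (by fun_prop)
    · exact (Complex.differentiable_one_div_Gamma.continuous.comp
        (continuous_add_const (m : ℂ))).norm.continuousAt
  have hev : ∀ᶠ s in nhds s₀, g s < g s₀ + 1 ∧ 0 < (s + m).re :=
    (hg.eventually_lt continuousAt_const (lt_add_one _)).and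
      (ContinuousAt.eventually_lt (by fun_prop) (by fun_prop) hre)
  obtain ⟨U, hU, hUo, hsU⟩ := eventually_nhds_iff.1 hev
  refine ⟨U, hUo, hsU, fun k => (2 ^ m * (g s₀ + 1)) * (((k + 1 : ℕ) : ℝ) ^ m * (1 / 2) ^ (k + 1)),
    ?_, fun k s hs => ?_⟩
  · exact ((summable_nat_add_iff 1).2
      (summable_pow_mul_geometric_of_norm_lt_one m (r := (1 / 2 : ℝ)) (by norm_num))).mul_left _
  · obtain ⟨hgs, hs0⟩ := hU s hs
    have h := norm_hasseDiff_sub_nat_le m k hs0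
    rw [add_sub_cancel_right] at h
    have h2 : ‖(1 / 2 ^ (k + 1) : ℂ)‖ = (1 / 2 : ℝ) ^ (k + 1) := by simp
    rw [norm_mul, h2]
    calc (1 / 2 : ℝ) ^ (k + 1) * ‖hasseDiff k s‖
        ≤ (1 / 2 : ℝ) ^ (k + 1) * ((2 * (k + 1 : ℝ)) ^ m * (g s₀ + 1)) := by
          gcongr
          exact h.trans (by gcongr)
      _ = _ := by rw [mul_pow]; push_cast; ring

lemma summable_hasse (s : ℂ) :
    Summable fun k : ℕ => (1 / 2 ^ (k + 1) : ℂ) * hasseDiff k s := by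
  obtain ⟨U, -, hs, u, hu, hb⟩ := exists_summable_bound_hasseDiff s
  exact Summable.of_norm_bounded hu fun k => hb k s hs

lemma differentiable_tsum_hasse :
    Differentiable ℂ fun s => ∑' k : ℕ, (1 / 2 ^ (k + 1) : ℂ) * hasseDiff k s := by
  intro s
  obtain ⟨U, hU, hs, u, hu, hb⟩ := exists_summable_bound_hasseDiff s
  exact (Complex.differentiableOn_tsum_of_summable_norm hu
    (fun k => ((differentiable_hasseDiff k).const_mul _).differentiableOn) hU hb).differentiableAt
    (hU.mem_nhds hs)

lemma tsum_hasse_of_one_lt_re {s : ℂ} (hs : 1 < s.re) :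
    ∑' k : ℕ, (1 / 2 ^ (k + 1) : ℂ) * hasseDiff k s =
      (1 - (2 : ℂ) ^ (1 - s)) * riemannZeta s := by
  rw [← tsum_alternating_nat_add_one_cpow hs]
  exact (hasSum_euler_transform (summable_norm_nat_add_one_cpow hs)).tsum_eq

lemma tsum_hasse {s : ℂ} (hs : s ≠ 1) :
    ∑' k : ℕ, (1 / 2 ^ (k + 1) : ℂ) * hasseDiff k s =
      (1 - (2 : ℂ) ^ (1 - s)) * riemannZeta s := by
  have hpre : IsPreconnected ({1}ᶜ : Set ℂ) :=
    (isConnected_compl_singleton_of_one_lt_rank (by simp) 1).isPreconnected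
  have hzeta : DifferentiableOn ℂ (fun s => (1 - (2 : ℂ) ^ (1 - s)) * riemannZeta s) {1}ᶜ := by
    intro z hz
    refine DifferentiableAt.differentiableWithinAt (.mul ?_ (differentiableAt_riemannZeta hz))
    exact (DifferentiableAt.const_cpow (by fun_prop) (Or.inl two_ne_zero)).const_sub _
  refine AnalyticOnNhd.eqOn_of_preconnected_of_eventuallyEq
    (differentiable_tsum_hasse.differentiableOn.analyticOnNhd isOpen_compl_singleton)
    (hzeta.analyticOnNhd isOpen_compl_singleton) hpre (z₀ := 2) (by simp) ?_ hs
  filter_upwards [(isOpen_lt continuous_const Complex.continuous_re).mem_nhds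
    (show (1 : ℝ) < (2 : ℂ).re by simp)] with z hz
  exact tsum_hasse_of_one_lt_re hz

/-- Hasse's globally convergent series for the Riemann zeta function: for every `s ≠ 1`,
`(1 − 2^{1−s}) ζ(s) = ∑_{k=0}^{∞} 2^{−(k+1)} ∑_{j=0}^{k} (−1)^j C(k,j) (j+1)^{−s}`. -/
theorem stmt_19 (s : ℂ) (hs : s ≠ 1) :
    Tendsto (fun K : ℕ => ∑ k ∈ Finset.range K,
        (1 / 2 ^ (k + 1) : ℂ) *
          ∑ j ∈ Finset.range (k + 1), (-1 : ℂ) ^ j * (k.choose j : ℂ) * ((j : ℂ) + 1) ^ (-s))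
      atTop (nhds ((1 - (2 : ℂ) ^ (1 - s)) * riemannZeta s)) := by
  rw [← tsum_hasse hs]
  exact (summable_hasse s).hasSum.tendsto_sum_nat
end
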